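/- arXiv:1005.0101 — 9 statements merged into one kernel-verified Lean document; each statement's English description precedes it below -/
import Mathlib

section
/- Let T : [t₀,θ₀]×ℝⁿ → 𝒫(ℝ²) be a set-valued map with closed graph. Then condition (N3) holds for T if and only if the following local condition holds: for every (t*,x*) ∈ [t₀,θ₀)×ℝⁿ and every (J₁,J₂) ∈ T(t*,x*) there exist θ ∈ (t*,θ₀] and y ∈ Sol(t*,x*) such that (J₁,J₂) ∈ T(t,y(t)) for all t ∈ [t*,θ]. -/
open Set Filter MeasureTheory

noncomputable section

/-- `F(t,x)` : the convex hull of the set of velocities `f(t,x,u,v)`, `u ∈ P`, `v ∈ Q`. -/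
def velSet {n p q : ℕ}
    (f : ℝ → EuclideanSpace ℝ (Fin n) → EuclideanSpace ℝ (Fin p) → EuclideanSpace ℝ (Fin q) →
      EuclideanSpace ℝ (Fin n))
    (P : Set (EuclideanSpace ℝ (Fin p))) (Q : Set (EuclideanSpace ℝ (Fin q)))
    (t : ℝ) (x : EuclideanSpace ℝ (Fin n)) : Set (EuclideanSpace ℝ (Fin n)) :=
  convexHull ℝ {z | ∃ u ∈ P, ∃ v ∈ Q, z = f t x u v}

/-- `y ∈ Sol(t*,x*)` : a Lipschitz solution on `[t*,θ₀]` of the differential inclusion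
`ẏ ∈ F(t,y)` with `y(t*) = x*`. -/
def IsSol {n : ℕ} (F : ℝ → EuclideanSpace ℝ (Fin n) → Set (EuclideanSpace ℝ (Fin n)))
    (θ₀ tstar : ℝ) (xstar : EuclideanSpace ℝ (Fin n)) (y : ℝ → EuclideanSpace ℝ (Fin n)) : Prop :=
  (∃ K : NNReal, LipschitzOnWith K y (Icc tstar θ₀)) ∧ y tstar = xstar ∧
    ∀ᵐ t ∂(volume.restrict (Icc tstar θ₀)), ∃ v ∈ F t (y t), HasDerivAt y v t

/-- Condition (N3): from every point of the graph of `T` a solution of the differential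
inclusion starts along which the pair of payoffs remains in the values of `T` up to time `θ₀`. -/
def CondN3 {n : ℕ} (t₀ θ₀ : ℝ)
    (F : ℝ → EuclideanSpace ℝ (Fin n) → Set (EuclideanSpace ℝ (Fin n)))
    (T : ℝ → EuclideanSpace ℝ (Fin n) → Set (ℝ × ℝ)) : Prop :=
  ∀ tstar ∈ Icc t₀ θ₀, ∀ xstar : EuclideanSpace ℝ (Fin n), ∀ J ∈ T tstar xstar,
    ∃ y : ℝ → EuclideanSpace ℝ (Fin n), IsSol F θ₀ tstar xstar y ∧
      ∀ t ∈ Icc tstar θ₀, J ∈ T t (y t)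

open scoped NNReal

theorem LipschitzOnWith.sub_le_of_ae_hasDerivAt_le {g : ℝ → ℝ} {K : ℝ≥0} {a b M : ℝ} (hab : a ≤ b)
    (hg : LipschitzOnWith K g (Icc a b))
    (hd : ∀ᵐ t ∂(volume.restrict (Icc a b)), ∃ d ≤ M, HasDerivAt g d t) :
    g b - g a ≤ M * (b - a) := by
  rw [← uIcc_of_le hab] at hg
  have hac := hg.absolutelyContinuousOnInterval
  rw [← hac.integral_deriv_eq_sub]
  calc ∫ t in a..b, deriv g t ≤ ∫ _ in a..b, M := by
        refine intervalIntegral.integral_mono_ae_restrict hab hac.intervalIntegrable_deriv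
          intervalIntegrable_const ?_
        filter_upwards [hd] with t ⟨d, hdM, hdt⟩
        rwa [hdt.deriv]
    _ = M * (b - a) := by simp [mul_comm]

theorem norm_sub_le_of_lipschitzOnWith_of_ae_hasDerivAt {E : Type*} [NormedAddCommGroup E]
    [InnerProductSpace ℝ E] {y : ℝ → E} {K : ℝ≥0} {a b M : ℝ} (hab : a ≤ b)
    (hy : LipschitzOnWith K y (Icc a b))
    (hd : ∀ᵐ t ∂(volume.restrict (Icc a b)), ∃ v, ‖v‖ ≤ M ∧ HasDerivAt y v t) :
    ‖y b - y a‖ ≤ M * (b - a) := by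
  set w := y b - y a with hw
  have hlip : LipschitzOnWith (‖innerSL ℝ w‖₊ * K) (fun t => innerSL ℝ w (y t)) (Icc a b) :=
    (innerSL ℝ w).lipschitz.comp_lipschitzOnWith hy
  have key := hlip.sub_le_of_ae_hasDerivAt_le (M := ‖w‖ * M) hab (by
    filter_upwards [hd] with t ⟨v, hv, hvt⟩
    refine ⟨innerSL ℝ w v, ?_, (innerSL ℝ w).hasFDerivAt.comp_hasDerivAt t hvt⟩
    calc innerSL ℝ w v ≤ ‖w‖ * ‖v‖ := real_inner_le_norm w v
      _ ≤ ‖w‖ * M := by gcongr)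
  rw [← map_sub, ← hw, innerSL_apply_apply, real_inner_self_eq_norm_sq] at key
  rcases (norm_nonneg w).eq_or_lt with h0 | h0
  · rcases hab.eq_or_lt with rfl | hlt
    · simp [hw]
    · have hne : NeBot (ae (volume.restrict (Icc a b))) := by
        rw [ae_neBot, Ne, Measure.restrict_eq_zero, Real.volume_Icc]
        simpa using hlt
      obtain ⟨t, v, hv, -⟩ := hd.exists
      rw [← h0]
      exact mul_nonneg ((norm_nonneg v).trans hv) (sub_nonneg.2 hab)
  · refine le_of_mul_le_mul_left ?_ h0
    linarith

theorem lipschitzWith_log_one_add_sq : LipschitzWith 1 (fun r : ℝ => Real.log (1 + r ^ 2)) := by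
  have hderiv : ∀ r : ℝ,
      HasDerivAt (fun r : ℝ => Real.log (1 + r ^ 2)) (2 * r / (1 + r ^ 2)) r := fun r => by
    have h : HasDerivAt (fun r : ℝ => 1 + r ^ 2) (2 * r) r := by
      simpa using (hasDerivAt_pow 2 r).const_add 1
    exact h.log (by positivity)
  refine lipschitzWith_of_nnnorm_deriv_le (fun r => (hderiv r).differentiableAt) fun r => ?_
  rw [(hderiv r).deriv, ← NNReal.coe_le_coe, coe_nnnorm, Real.norm_eq_abs, abs_div,
    abs_of_pos (by positivity : (0 : ℝ) < 1 + r ^ 2), NNReal.coe_one, div_le_one (by positivity),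
    abs_le]
  constructor <;> nlinarith [sq_nonneg (r - 1), sq_nonneg (r + 1)]

section Inclusion

variable {n : ℕ} {F : ℝ → EuclideanSpace ℝ (Fin n) → Set (EuclideanSpace ℝ (Fin n))}

theorem IsSol.mono {θ θ' s : ℝ} {x : EuclideanSpace ℝ (Fin n)} {y : ℝ → EuclideanSpace ℝ (Fin n)}
    (h : IsSol F θ' s x y) (hθ : θ ≤ θ') : IsSol F θ s x y := by
  obtain ⟨⟨K, hK⟩, h0, hd⟩ := h
  have hsub : Icc s θ ⊆ Icc s θ' := Icc_subset_Icc_right hθ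
  exact ⟨⟨K, hK.mono hsub⟩, h0, ae_restrict_of_ae_restrict_of_subset hsub hd⟩

theorem isSol_const (s : ℝ) (x : EuclideanSpace ℝ (Fin n)) : IsSol F s s x fun _ => x := by
  refine ⟨⟨0, (LipschitzWith.const x).lipschitzOnWith⟩, rfl, ?_⟩
  simp

/-- A priori estimate: under sublinear growth all solutions issuing from `(s, x)` share a
Lipschitz constant, whatever the length of their interval of definition. -/
theorem exists_lipschitzOnWith_of_isSol {s θ₀ C : ℝ} (hC : 0 ≤ C)
    (hF : ∀ t ∈ Icc s θ₀, ∀ x, ∀ v ∈ F t x, ‖v‖ ≤ C * (1 + ‖x‖)) (x : EuclideanSpace ℝ (Fin n)) :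
    ∃ K : ℝ≥0, ∀ θ ∈ Icc s θ₀, ∀ y, IsSol F θ s x y → LipschitzOnWith K y (Icc s θ) := by
  set B := Real.log (1 + ‖x‖ ^ 2) + 4 * C * (θ₀ - s)
  set R := Real.exp B
  have hR : 0 < R := Real.exp_pos B
  refine ⟨⟨C * (1 + R), by positivity⟩, fun θ hθ y ⟨⟨K, hK⟩, h0, hd⟩ => ?_⟩
  have hd' : ∀ᵐ t ∂(volume.restrict (Icc s θ)), ∃ v, ‖v‖ ≤ C * (1 + ‖y t‖) ∧ HasDerivAt y v t := by
    filter_upwards [hd, ae_restrict_mem measurableSet_Icc] with t ⟨v, hv, hvt⟩ htI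
    exact ⟨v, hF t ⟨htI.1, htI.2.trans hθ.2⟩ _ v hv, hvt⟩
  have hbound : ∀ t ∈ Icc s θ, ‖y t‖ ≤ R := by
    intro t htI
    have hsub : Icc s t ⊆ Icc s θ := Icc_subset_Icc_right htI.2
    have hlip : LipschitzOnWith (1 * (1 * K)) (fun τ => Real.log (1 + ‖y τ‖ ^ 2)) (Icc s t) :=
      lipschitzWith_log_one_add_sq.comp_lipschitzOnWith
        (lipschitzWith_one_norm.comp_lipschitzOnWith (hK.mono hsub))
    have key := hlip.sub_le_of_ae_hasDerivAt_le (M := 4 * C) htI.1 (by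
      filter_upwards [ae_restrict_of_ae_restrict_of_subset hsub hd'] with τ ⟨v, hv, hvt⟩
      refine ⟨_, ?_, (hvt.norm_sq.const_add 1).log (by positivity)⟩
      rw [div_le_iff₀ (by positivity)]
      have h1 : inner ℝ (y τ) v ≤ ‖y τ‖ * (C * (1 + ‖y τ‖)) :=
        (real_inner_le_norm _ _).trans (by gcongr)
      nlinarith [mul_nonneg hC (sq_nonneg (‖y τ‖ - 1)), mul_nonneg hC (sq_nonneg ‖y τ‖)])
    rw [h0] at key
    have h2 : 4 * C * (t - s) ≤ 4 * C * (θ₀ - s) := by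
      have := htI.2.trans hθ.2
      gcongr
    have h3 : 1 + ‖y t‖ ^ 2 ≤ R :=
      (Real.log_le_iff_le_exp (by positivity)).1 (by simp only [B]; linarith)
    nlinarith [sq_nonneg (‖y t‖ - 1)]
  refine LipschitzOnWith.of_dist_le_mul fun b hb a ha => ?_
  wlog hab : a ≤ b generalizing a b
  · rw [dist_comm, dist_comm b]
    exact this a ha b hb (le_of_not_ge hab)
  have hsub : Icc a b ⊆ Icc s θ := Icc_subset_Icc ha.1 hb.2
  rw [dist_eq_norm, Real.dist_eq, abs_of_nonneg (sub_nonneg.2 hab)]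
  refine norm_sub_le_of_lipschitzOnWith_of_ae_hasDerivAt hab (hK.mono hsub) ?_
  filter_upwards [ae_restrict_of_ae_restrict_of_subset hsub hd',
    ae_restrict_mem measurableSet_Icc] with t ⟨v, hv, hvt⟩ htI
  refine ⟨v, hv.trans ?_, hvt⟩
  have := hbound t (hsub htI)
  change _ ≤ C * (1 + R)
  gcongr

theorem IsSol.concat {s θ θ' : ℝ} {x : EuclideanSpace ℝ (Fin n)}
    {y z : ℝ → EuclideanSpace ℝ (Fin n)} (hsθ : s ≤ θ) (hθ : θ ≤ θ') (hy : IsSol F θ s x y)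
    (hz : IsSol F θ' θ (y θ) z) : IsSol F θ' s x (fun t => if t ≤ θ then y t else z t) := by
  obtain ⟨⟨K, hK⟩, hy0, hyd⟩ := hy
  obtain ⟨⟨K', hK'⟩, hz0, hzd⟩ := hz
  refine ⟨⟨max K K', LipschitzOnWith.of_dist_le_mul fun a ha b hb => ?_⟩, by simp [hsθ, hy0], ?_⟩
  · have h1 := (hK.weaken (le_max_left K K')).dist_le_mul
    have h2 := (hK'.weaken (le_max_right K K')).dist_le_mul
    wlog hab : a ≤ b generalizing a b
    · rw [dist_comm, dist_comm a]
      exact this b hb a ha (le_of_not_ge hab)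
    by_cases hbθ : b ≤ θ
    · simpa [hbθ, hab.trans hbθ] using h1 a ⟨ha.1, hab.trans hbθ⟩ b ⟨hb.1, hbθ⟩
    have hbθ' := lt_of_not_ge hbθ
    by_cases haθ : a ≤ θ
    · simp only [haθ, hbθ, if_true, if_false]
      refine (dist_triangle _ (y θ) _).trans ?_
      have e1 := h1 a ⟨ha.1, haθ⟩ θ ⟨hsθ, le_rfl⟩
      have e2 := h2 θ ⟨le_rfl, hθ⟩ b ⟨hbθ'.le, hb.2⟩
      rw [hz0] at e2
      refine (add_le_add e1 e2).trans_eq ?_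
      rw [← mul_add, Real.dist_eq, Real.dist_eq, Real.dist_eq, abs_of_nonpos (by linarith),
        abs_of_nonpos (by linarith), abs_of_nonpos (by linarith)]
      ring
    · simpa [haθ, hbθ] using h2 a ⟨(lt_of_not_ge haθ).le, ha.2⟩ b ⟨hbθ'.le, hb.2⟩
  · rw [ae_restrict_iff' measurableSet_Icc] at hyd hzd ⊢
    filter_upwards [hyd, hzd, Measure.ae_ne volume θ] with t h1 h2 hne ht
    rcases lt_or_gt_of_ne hne with hlt | hgt
    · obtain ⟨v, hv, hvt⟩ := h1 ⟨ht.1, hlt.le⟩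
      refine ⟨v, by simpa [hlt.le] using hv, hvt.congr_of_eventuallyEq ?_⟩
      filter_upwards [Iio_mem_nhds hlt] with τ hτ
      simp [(mem_Iio.1 hτ).le]
    · obtain ⟨v, hv, hvt⟩ := h2 ⟨hgt.le, ht.2⟩
      refine ⟨v, by simpa [hgt.not_ge] using hv, hvt.congr_of_eventuallyEq ?_⟩
      filter_upwards [Ioi_mem_nhds hgt] with τ hτ
      simp [(mem_Ioi.1 hτ).not_ge]

/-- A family of compatible, uniformly Lipschitz solutions extends to a solution on the interval
up to the supremum of the right endpoints. -/
theorem exists_isSol_sSup {s : ℝ} {x : EuclideanSpace ℝ (Fin n)} {K : ℝ≥0}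
    {c : Set (ℝ × (ℝ → EuclideanSpace ℝ (Fin n)))} (hne : c.Nonempty)
    (hbdd : BddAbove (Prod.fst '' c)) (hs : ∀ a ∈ c, s ≤ a.1)
    (hsol : ∀ a ∈ c, IsSol F a.1 s x a.2) (hlip : ∀ a ∈ c, LipschitzOnWith K a.2 (Icc s a.1))
    (hcompat : ∀ a ∈ c, ∀ b ∈ c, a.1 ≤ b.1 → EqOn a.2 b.2 (Icc s a.1)) :
    ∃ g, Continuous g ∧ IsSol F (sSup (Prod.fst '' c)) s x g ∧
      ∀ a ∈ c, EqOn a.2 g (Icc s a.1) := by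
  classical
  let S : Set ℝ := {t | ∃ a ∈ c, t ∈ Icc s a.1}
  let y : ℝ → EuclideanSpace ℝ (Fin n) := fun t => if h : t ∈ S then h.choose.2 t else 0
  have hy : ∀ a ∈ c, EqOn a.2 y (Icc s a.1) := by
    intro a ha t hta
    have h : t ∈ S := ⟨a, ha, hta⟩
    have hyt : y t = h.choose.2 t := dif_pos h
    obtain ⟨hb, htb⟩ := h.choose_spec
    rw [hyt]
    rcases le_total a.1 h.choose.1 with hle | hle
    · exact hcompat _ ha _ hb hle hta
    · exact (hcompat _ hb _ ha hle htb).symm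
  have hyS : LipschitzOnWith K y S := by
    refine LipschitzOnWith.of_dist_le_mul ?_
    rintro t ⟨a, ha, hta⟩ τ ⟨b, hb, hτb⟩
    rcases le_total a.1 b.1 with hle | hle
    · have hta' : t ∈ Icc s b.1 := ⟨hta.1, hta.2.trans hle⟩
      rw [← hy b hb hta', ← hy b hb hτb]
      exact (hlip b hb).dist_le_mul t hta' τ hτb
    · have hτb' : τ ∈ Icc s a.1 := ⟨hτb.1, hτb.2.trans hle⟩
      rw [← hy a ha hta, ← hy a ha hτb']
      exact (hlip a ha).dist_le_mul t hta τ hτb'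
  obtain ⟨g, hg, hgy⟩ := hyS.extend_finite_dimension
  have hag : ∀ a ∈ c, EqOn a.2 g (Icc s a.1) := fun a ha t hta =>
    (hy a ha hta).trans (hgy ⟨a, ha, hta⟩)
  refine ⟨g, hg.continuous, ⟨⟨_, hg.lipschitzOnWith⟩, ?_, ?_⟩, hag⟩
  · obtain ⟨a, ha⟩ := hne
    rw [← hag a ha ⟨le_rfl, hs a ha⟩, (hsol a ha).2.1]
  · obtain ⟨u, -, hu, huc⟩ := exists_seq_tendsto_sSup (hne.image Prod.fst) hbdd
    choose a ha hau using huc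
    have hd := ae_all_iff.2 fun k =>
      (ae_restrict_iff' measurableSet_Icc).1 (hsol (a k) (ha k)).2.2
    rw [ae_restrict_iff' measurableSet_Icc]
    filter_upwards [hd, Measure.ae_ne volume s, Measure.ae_ne volume (sSup (Prod.fst '' c))]
      with t htd hts htσ ht
    obtain ⟨k, hk⟩ := (hu.eventually (lt_mem_nhds (lt_of_le_of_ne ht.2 htσ))).exists
    rw [← hau k] at hk
    obtain ⟨v, hv, hvt⟩ := htd k ⟨ht.1, hk.le⟩
    have heq := hag (a k) (ha k)
    rw [heq ⟨ht.1, hk.le⟩] at hv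
    refine ⟨v, hv, hvt.congr_of_eventuallyEq ?_⟩
    filter_upwards [Icc_mem_nhds (lt_of_le_of_ne ht.1 hts.symm) hk] with τ hτ
    exact (heq hτ).symm

theorem condN3_of_local {t₀ θ₀ C : ℝ} (hC : 0 ≤ C)
    (hF : ∀ t ∈ Icc t₀ θ₀, ∀ x, ∀ v ∈ F t x, ‖v‖ ≤ C * (1 + ‖x‖))
    {T : ℝ → EuclideanSpace ℝ (Fin n) → Set (ℝ × ℝ)}
    (hT : IsClosed {z : ℝ × EuclideanSpace ℝ (Fin n) × (ℝ × ℝ) |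
      z.1 ∈ Icc t₀ θ₀ ∧ z.2.2 ∈ T z.1 z.2.1})
    (hloc : ∀ s ∈ Ico t₀ θ₀, ∀ x : EuclideanSpace ℝ (Fin n), ∀ J ∈ T s x,
      ∃ θ ∈ Ioc s θ₀, ∃ y : ℝ → EuclideanSpace ℝ (Fin n),
        IsSol F θ₀ s x y ∧ ∀ t ∈ Icc s θ, J ∈ T t (y t)) :
    CondN3 t₀ θ₀ F T := by
  intro s hs x J hJ
  obtain ⟨K, hK⟩ := exists_lipschitzOnWith_of_isSol hC
    (fun t (ht : t ∈ Icc s θ₀) => hF t ⟨hs.1.trans ht.1, ht.2⟩) x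
  let Seg := {a : ℝ × (ℝ → EuclideanSpace ℝ (Fin n)) //
    a.1 ∈ Icc s θ₀ ∧ IsSol F a.1 s x a.2 ∧ ∀ t ∈ Icc s a.1, J ∈ T t (a.2 t)}
  let r : Seg → Seg → Prop := fun a b => a.1.1 ≤ b.1.1 ∧ EqOn a.1.2 b.1.2 (Icc s a.1.1)
  have : Nonempty Seg := ⟨⟨(s, fun _ => x), ⟨le_rfl, hs.2⟩, isSol_const s x, fun t ht => by
    obtain rfl : t = s := le_antisymm ht.2 ht.1
    exact hJ⟩⟩
  obtain ⟨⟨⟨θ, y⟩, hθ, hy, hyT⟩, hmax⟩ : ∃ m, ∀ a, r m a → r a m := by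
    refine exists_maximal_of_nonempty_chains_bounded (fun c hc hcne => ?_)
      fun {a b d} hab hbd => ⟨hab.1.trans hbd.1, fun t ht =>
        (hab.2 ht).trans (hbd.2 ⟨ht.1, ht.2.trans hab.1⟩)⟩
    have hbdd : BddAbove (Prod.fst '' (Subtype.val '' c)) := by
      refine ⟨θ₀, ?_⟩
      rintro _ ⟨_, ⟨a, -, rfl⟩, rfl⟩
      exact a.2.1.2
    obtain ⟨g, hg, hsol, hag⟩ := exists_isSol_sSup (F := F) (s := s) (x := x) (K := K)
      (hcne.image Subtype.val) hbdd
      (by rintro _ ⟨a, -, rfl⟩; exact a.2.1.1) (by rintro _ ⟨a, -, rfl⟩; exact a.2.2.1)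
      (by rintro _ ⟨a, -, rfl⟩; exact hK _ a.2.1 _ a.2.2.1) (by
        rintro _ ⟨a, ha, rfl⟩ _ ⟨b, hb, rfl⟩ hle
        by_cases hab : a = b
        · rw [hab]; exact eqOn_refl _ _
        rcases hc ha hb hab with h | h
        · exact h.2
        · exact fun t ht => (h.2 ⟨ht.1, ht.2.trans hle⟩).symm)
    set σ := sSup (Prod.fst '' (Subtype.val '' c))
    have hle : ∀ a ∈ c, a.1.1 ≤ σ := fun a ha =>
      le_csSup hbdd ⟨_, ⟨a, ha, rfl⟩, rfl⟩
    have hσ : σ ∈ Icc s θ₀ := by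
      obtain ⟨a, ha⟩ := hcne
      refine ⟨a.2.1.1.trans (hle a ha), csSup_le ⟨_, _, ⟨a, ha, rfl⟩, rfl⟩ ?_⟩
      rintro _ ⟨_, ⟨b, -, rfl⟩, rfl⟩
      exact b.2.1.2
    have hgT : ∀ t ∈ Icc s σ, J ∈ T t (g t) := by
      have hcl : IsClosed {t | t ∈ Icc t₀ θ₀ ∧ J ∈ T t (g t)} :=
        hT.preimage (f := fun t => (t, g t, J)) (by fun_prop)
      have hmem : ∀ a ∈ c, ∀ t ∈ Icc s a.1.1, t ∈ {t | t ∈ Icc t₀ θ₀ ∧ J ∈ T t (g t)} := by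
        intro a ha t ht
        refine ⟨⟨hs.1.trans ht.1, ht.2.trans a.2.1.2⟩, ?_⟩
        rw [← hag _ ⟨a, ha, rfl⟩ ht]
        exact a.2.2.2 t ht
      rcases hσ.1.eq_or_lt with heq | hlt
      · obtain ⟨a, ha⟩ := hcne
        intro t ht
        obtain rfl : t = s := le_antisymm (ht.2.trans heq.ge) ht.1
        exact (hmem a ha t ⟨le_rfl, a.2.1.1⟩).2
      · have hsub : Ico s σ ⊆ {t | t ∈ Icc t₀ θ₀ ∧ J ∈ T t (g t)} := by
          intro t ht
          obtain ⟨_, ⟨_, ⟨a, ha, rfl⟩, rfl⟩, hta⟩ :=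
            exists_lt_of_lt_csSup ((hcne.image Subtype.val).image Prod.fst) ht.2
          exact hmem a ha t ⟨ht.1, hta.le⟩
        have := closure_minimal hsub hcl
        rw [closure_Ico hlt.ne] at this
        exact fun t ht => (this ht).2
    exact ⟨⟨(σ, g), hσ, hsol, hgT⟩, fun a ha => ⟨hle a ha, hag _ ⟨a, ha, rfl⟩⟩⟩
  rcases hθ.2.eq_or_lt with heq | hlt
  · obtain rfl : θ = θ₀ := heq
    exact ⟨y, hy, hyT⟩
  · obtain ⟨θ', hθ', z, hz, hzT⟩ :=
      hloc θ ⟨hs.1.trans hθ.1, hlt⟩ (y θ) J (hyT θ ⟨hθ.1, le_rfl⟩)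
    have hext := hmax ⟨(θ', fun t => if t ≤ θ then y t else z t),
      ⟨hθ.1.trans hθ'.1.le, hθ'.2⟩, hy.concat hθ.1 hθ'.1.le (hz.mono hθ'.2), fun t ht => by
        by_cases h : t ≤ θ
        · simpa [h] using hyT t ⟨ht.1, h⟩
        · simpa [h] using hzT t ⟨(lt_of_not_ge h).le, ht.2⟩⟩
      ⟨hθ'.1.le, fun t ht => by simp [ht.2]⟩
    exact absurd hext.1 hθ'.1.not_ge

end Inclusion

theorem norm_le_of_mem_velSet {n p q : ℕ}
    {f : ℝ → EuclideanSpace ℝ (Fin n) → EuclideanSpace ℝ (Fin p) → EuclideanSpace ℝ (Fin q) →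
      EuclideanSpace ℝ (Fin n)}
    {P : Set (EuclideanSpace ℝ (Fin p))} {Q : Set (EuclideanSpace ℝ (Fin q))} {t M : ℝ}
    {x z : EuclideanSpace ℝ (Fin n)} (hf : ∀ u ∈ P, ∀ v ∈ Q, ‖f t x u v‖ ≤ M)
    (hz : z ∈ velSet f P Q t x) : ‖z‖ ≤ M := by
  rw [← mem_closedBall_zero_iff]
  refine convexHull_min ?_ (convex_closedBall 0 M) hz
  rintro _ ⟨u, hu, v, hv, rfl⟩
  exact mem_closedBall_zero_iff.2 (hf u hu v hv)

/-- Theorem 1 (Theorem `th_weak_inv`): for a closed multivalued map `T`, condition (N3) is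
equivalent to its local version. -/
theorem weak_invariance_local_characterization
    {n p q : ℕ} (t₀ θ₀ : ℝ) (ht : t₀ < θ₀)
    (P : Set (EuclideanSpace ℝ (Fin p))) (Q : Set (EuclideanSpace ℝ (Fin q)))
    (hPne : P.Nonempty) (hPc : IsCompact P) (hQne : Q.Nonempty) (hQc : IsCompact Q)
    (f : ℝ → EuclideanSpace ℝ (Fin n) → EuclideanSpace ℝ (Fin p) → EuclideanSpace ℝ (Fin q) →
      EuclideanSpace ℝ (Fin n))
    (hf_cont : ContinuousOn
      (fun z : ℝ × EuclideanSpace ℝ (Fin n) × EuclideanSpace ℝ (Fin p) × EuclideanSpace ℝ (Fin q) =>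
        f z.1 z.2.1 z.2.2.1 z.2.2.2)
      (Icc t₀ θ₀ ×ˢ (univ : Set (EuclideanSpace ℝ (Fin n))) ×ˢ P ×ˢ Q))
    (hf_lip : ∃ L : ℝ, ∀ t ∈ Icc t₀ θ₀, ∀ u ∈ P, ∀ v ∈ Q,
      ∀ x x' : EuclideanSpace ℝ (Fin n), ‖f t x u v - f t x' u v‖ ≤ L * ‖x - x'‖)
    (hf_growth : ∃ C : ℝ, ∀ t ∈ Icc t₀ θ₀, ∀ u ∈ P, ∀ v ∈ Q,
      ∀ x : EuclideanSpace ℝ (Fin n), ‖f t x u v‖ ≤ C * (1 + ‖x‖))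
    (T : ℝ → EuclideanSpace ℝ (Fin n) → Set (ℝ × ℝ))
    (hT_closed : IsClosed {z : ℝ × EuclideanSpace ℝ (Fin n) × (ℝ × ℝ) |
      z.1 ∈ Icc t₀ θ₀ ∧ z.2.2 ∈ T z.1 z.2.1}) :
    CondN3 t₀ θ₀ (velSet f P Q) T ↔
      (∀ tstar ∈ Ico t₀ θ₀, ∀ xstar : EuclideanSpace ℝ (Fin n), ∀ J ∈ T tstar xstar,
        ∃ θ ∈ Ioc tstar θ₀, ∃ y : ℝ → EuclideanSpace ℝ (Fin n),
          IsSol (velSet f P Q) θ₀ tstar xstar y ∧ ∀ t ∈ Icc tstar θ, J ∈ T t (y t)) := by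
  constructor
  · intro h s hs x J hJ
    obtain ⟨y, hy, hyT⟩ := h s (Ico_subset_Icc_self hs) x J hJ
    exact ⟨θ₀, ⟨hs.2, le_rfl⟩, y, hy, hyT⟩
  · obtain ⟨C, hC⟩ := hf_growth
    refine condN3_of_local (abs_nonneg C) (fun t ht x w hw => ?_) hT_closed
    refine norm_le_of_mem_velSet (fun u hu v hv => (hC t ht u hu v hv x).trans ?_) hw
    gcongr
    exact le_abs_self C
end
end

section
/- Let T : [t₀,θ₀]×ℝⁿ → 𝒫(ℝ²) be a set-valued map with closed graph and nonempty compact values. Then condition (N3) holds for T if and only if for every (t*,x*) ∈ [t₀,θ₀)×ℝⁿ one has sup over (J₁,J₂) ∈ T(t*,x*) of the inf over w ∈ F(t*,x*) of D̂T(t*,x*;(J₁,J₂),w) equal to 0. -/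
open Set Filter MeasureTheory
open scoped ENNReal NNReal Topology

noncomputable section

/-- The planar distance `dist[(J₁,J₂), A] = inf {|ζ₁ - J₁| + |ζ₂ - J₂| : (ζ₁,ζ₂) ∈ A}`
(equal to `+∞` when `A = ∅`). -/
def pdist (J : ℝ × ℝ) (A : Set (ℝ × ℝ)) : ℝ≥0∞ :=
  ⨅ ζ ∈ A, ENNReal.ofReal (|ζ.1 - J.1| + |ζ.2 - J.2|)

/-- The directional derivative of the multivalued map `T`:
`D̂T(t,x;(J₁,J₂),w) = liminf _{δ↓0, w'→w} dist[(J₁,J₂), T(t+δ, x+δw')]/δ`. -/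
def Dhat {E : Type*} [NormedAddCommGroup E] [NormedSpace ℝ E]
    (T : ℝ → E → Set (ℝ × ℝ)) (t : ℝ) (x : E) (J : ℝ × ℝ) (w : E) : ℝ≥0∞ :=
  Filter.liminf (fun p : ℝ × E => pdist J (T (t + p.1) (x + p.1 • p.2)) / ENNReal.ofReal p.1)
    ((𝓝[>] (0 : ℝ)) ×ˢ 𝓝 w)

theorem IsCompact.convexHull_of_finiteDimensional {E : Type*} [NormedAddCommGroup E]
    [NormedSpace ℝ E] [FiniteDimensional ℝ E] {S : Set E} (hS : IsCompact S) :
    IsCompact (convexHull ℝ S) := by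
  have key : convexHull ℝ S = ⋃ k ∈ Iic (Module.finrank ℝ E + 1),
      (fun p : (Fin k → ℝ) × (Fin k → E) => ∑ i, p.1 i • p.2 i) ''
        (stdSimplex ℝ (Fin k) ×ˢ univ.pi fun _ => S) := by
    apply Subset.antisymm
    · intro x hx
      obtain ⟨ι, hι, z, w, hz, hai, hw, hsum, hx⟩ := eq_pos_convex_span_of_mem_convexHull hx
      have hcard : Fintype.card ι ≤ Module.finrank ℝ E + 1 := hai.card_le_finrank_succ.trans
        (Nat.add_le_add_right (Submodule.finrank_le _) 1)
      let e := Fintype.equivFin ι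
      refine mem_biUnion (x := Fintype.card ι) hcard ⟨(w ∘ e.symm, z ∘ e.symm), ⟨⟨?_, ?_⟩, ?_⟩, ?_⟩
      · exact fun i => (hw _).le
      · rw [← hsum]
        exact e.symm.sum_comp w
      · exact fun i _ => hz (mem_range_self _)
      · rw [← hx]
        exact e.symm.sum_comp (fun i => w i • z i)
    · refine iUnion₂_subset fun k _ => ?_
      rintro _ ⟨⟨a, z⟩, ⟨ha, hz⟩, rfl⟩
      exact (convex_convexHull ℝ S).sum_mem (fun i _ => ha.1 i) ha.2
        fun i _ => subset_convexHull ℝ S (hz i (mem_univ i))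
  rw [key]
  refine (finite_Iic _).isCompact_biUnion fun k _ => ?_
  refine ((isCompact_stdSimplex ℝ (Fin k)).prod (isCompact_univ_pi fun _ => hS)).image ?_
  fun_prop

/-- An upper semicontinuous (in the sense of support functions) set-valued map with closed convex
values and linear growth. -/
structure IsMarchaud {E : Type*} [NormedAddCommGroup E] [NormedSpace ℝ E]
    (F : ℝ → E → Set E) (t₀ θ₀ C : ℝ) : Prop where
  nonneg : 0 ≤ C
  convex : ∀ t ∈ Icc t₀ θ₀, ∀ x, Convex ℝ (F t x)
  closed : ∀ t ∈ Icc t₀ θ₀, ∀ x, IsClosed (F t x)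
  growth : ∀ t ∈ Icc t₀ θ₀, ∀ x, ∀ w ∈ F t x, ‖w‖ ≤ C * (1 + ‖x‖)
  usc : ∀ t ∈ Icc t₀ θ₀, ∀ x, ∀ l : E →L[ℝ] ℝ, ∀ c, (∀ w ∈ F t x, l w < c) →
    ∃ ρ > 0, ∀ u ∈ Icc t₀ θ₀, |u - t| < ρ → ∀ ξ, ‖ξ - x‖ < ρ → ∀ w ∈ F u ξ, l w < c

theorem velSet_isMarchaud {n p q : ℕ} {t₀ θ₀ C : ℝ}
    {P : Set (EuclideanSpace ℝ (Fin p))} {Q : Set (EuclideanSpace ℝ (Fin q))}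
    (hPc : IsCompact P) (hQc : IsCompact Q)
    {f : ℝ → EuclideanSpace ℝ (Fin n) → EuclideanSpace ℝ (Fin p) → EuclideanSpace ℝ (Fin q) →
      EuclideanSpace ℝ (Fin n)}
    (hf : ContinuousOn
      (fun z : ℝ × EuclideanSpace ℝ (Fin n) × EuclideanSpace ℝ (Fin p) × EuclideanSpace ℝ (Fin q) =>
        f z.1 z.2.1 z.2.2.1 z.2.2.2)
      (Icc t₀ θ₀ ×ˢ (univ : Set (EuclideanSpace ℝ (Fin n))) ×ˢ P ×ˢ Q))
    (hC : ∀ t ∈ Icc t₀ θ₀, ∀ u ∈ P, ∀ v ∈ Q,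
      ∀ x : EuclideanSpace ℝ (Fin n), ‖f t x u v‖ ≤ C * (1 + ‖x‖)) (hC0 : 0 ≤ C) :
    IsMarchaud (velSet f P Q) t₀ θ₀ C where
  nonneg := hC0
  convex t _ x := convex_convexHull ℝ _
  closed t ht x := by
    have : {z | ∃ u ∈ P, ∃ v ∈ Q, z = f t x u v} = (fun a => f t x a.1 a.2) '' (P ×ˢ Q) := by
      ext z
      constructor
      · rintro ⟨u, hu, v, hv, rfl⟩
        exact ⟨(u, v), ⟨hu, hv⟩, rfl⟩
      · rintro ⟨⟨u, v⟩, ⟨hu, hv⟩, rfl⟩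
        exact ⟨u, hu, v, hv, rfl⟩
    rw [velSet, this]
    refine (((hPc.prod hQc).image_of_continuousOn ?_).convexHull_of_finiteDimensional).isClosed
    exact hf.comp (f := fun a : EuclideanSpace ℝ (Fin p) × EuclideanSpace ℝ (Fin q) =>
      (t, x, a.1, a.2)) (by fun_prop) fun a ha => ⟨ht, mem_univ _, ha.1, ha.2⟩
  growth t ht x w hw := by
    have : velSet f P Q t x ⊆ Metric.closedBall 0 (C * (1 + ‖x‖)) := by
      refine convexHull_min ?_ (convex_closedBall _ _)
      rintro _ ⟨u, hu, v, hv, rfl⟩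
      simpa using hC t ht u hu v hv x
    simpa using this hw
  usc t ht x l c hlt := by
    have hev : ∀ᶠ y : ℝ × EuclideanSpace ℝ (Fin n) in 𝓝 (t, x), ∀ a ∈ P ×ˢ Q,
        y.1 ∈ Icc t₀ θ₀ → a ∈ P ×ˢ Q → l (f y.1 y.2 a.1 a.2) < c := by
      refine (hPc.prod hQc).eventually_forall_of_forall_eventually fun a ha => ?_
      have hcont : ContinuousWithinAt _ _ (t, x, a.1, a.2) :=
        (l.continuous.comp_continuousOn hf) (t, x, a.1, a.2) ⟨ht, mem_univ _, ha.1, ha.2⟩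
      have hlt' : l (f t x a.1 a.2) < c :=
        hlt _ (subset_convexHull ℝ _ ⟨a.1, ha.1, a.2, ha.2, rfl⟩)
      have h1 := hcont.eventually (eventually_lt_nhds hlt')
      rw [eventually_nhdsWithin_iff] at h1
      have hm : Tendsto (fun z : (ℝ × EuclideanSpace ℝ (Fin n)) ×
          (EuclideanSpace ℝ (Fin p) × EuclideanSpace ℝ (Fin q)) =>
            (z.1.1, z.1.2, z.2.1, z.2.2)) (𝓝 ((t, x), a)) (𝓝 (t, x, a.1, a.2)) :=
        Continuous.tendsto (by fun_prop) _
      filter_upwards [hm.eventually h1] with z hz hz1 hz2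
      exact hz ⟨hz1, mem_univ _, hz2.1, hz2.2⟩
    obtain ⟨ρ, hρ, hball⟩ := Metric.eventually_nhds_iff.1 hev
    refine ⟨ρ, hρ, fun u hu hut ξ hξ w hw => ?_⟩
    have hd : dist (u, ξ) (t, x) < ρ := by
      rw [Prod.dist_eq, max_lt_iff]
      exact ⟨by simpa [Real.dist_eq] using hut, by simpa [dist_eq_norm] using hξ⟩
    have hsub : velSet f P Q u ξ ⊆ {w | l w < c} := by
      refine convexHull_min ?_ (convex_halfSpace_lt l.isLinear c)
      rintro _ ⟨a, ha, b, hb, rfl⟩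
      exact hball hd (a, b) ⟨ha, hb⟩ hu ⟨ha, hb⟩
    exact hsub hw

theorem LipschitzOnWith.sub_le_of_ae_deriv_le {g : ℝ → ℝ} {K : ℝ≥0} {a b c : ℝ} (hab : a ≤ b)
    (hg : LipschitzOnWith K g (Icc a b))
    (hc : ∀ᵐ t ∂volume.restrict (Icc a b), deriv g t ≤ c) : g b - g a ≤ c * (b - a) := by
  have hac : AbsolutelyContinuousOnInterval g a b :=
    LipschitzOnWith.absolutelyContinuousOnInterval (by rwa [uIcc_of_le hab])
  rw [← hac.integral_deriv_eq_sub]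
  calc ∫ x in a..b, deriv g x ≤ ∫ _ in a..b, c :=
        intervalIntegral.integral_mono_ae_restrict hab hac.intervalIntegrable_deriv
          intervalIntegrable_const hc
    _ = c * (b - a) := by simp [mul_comm]

theorem Dhat_eq_zero_of_frequently {E : Type*} [NormedAddCommGroup E] [NormedSpace ℝ E]
    {T : ℝ → E → Set (ℝ × ℝ)} {t : ℝ} {x : E} {J : ℝ × ℝ} {w : E}
    (h : ∃ᶠ p : ℝ × E in (𝓝[>] (0 : ℝ)) ×ˢ 𝓝 w, J ∈ T (t + p.1) (x + p.1 • p.2)) :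
    Dhat T t x J w = 0 := by
  refine le_antisymm (liminf_le_of_frequently_le' (h.mono fun p hp => ?_)) bot_le
  have : pdist J (T (t + p.1) (x + p.1 • p.2)) = 0 :=
    le_antisymm ((iInf₂_le J hp).trans (by simp)) bot_le
  simp [this]

theorem exists_Dhat_eq_zero_of_isSol {n : ℕ} {t₀ θ₀ C tstar : ℝ}
    {F : ℝ → EuclideanSpace ℝ (Fin n) → Set (EuclideanSpace ℝ (Fin n))}
    (hF : IsMarchaud F t₀ θ₀ C) (hts : tstar ∈ Ico t₀ θ₀)
    {T : ℝ → EuclideanSpace ℝ (Fin n) → Set (ℝ × ℝ)} {J : ℝ × ℝ}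
    {xstar : EuclideanSpace ℝ (Fin n)} {y : ℝ → EuclideanSpace ℝ (Fin n)}
    (hy : IsSol F θ₀ tstar xstar y) (hJ : ∀ t ∈ Icc tstar θ₀, J ∈ T t (y t)) :
    ∃ w ∈ F tstar xstar, Dhat T tstar xstar J w = 0 := by
  obtain ⟨⟨K, hK⟩, rfl, hae⟩ := hy
  set U : Ultrafilter ℝ := Ultrafilter.of (𝓝[>] (0 : ℝ)) with hU
  have hUle : (U : Filter ℝ) ≤ 𝓝[>] (0 : ℝ) := Ultrafilter.of_le _
  let q : ℝ → EuclideanSpace ℝ (Fin n) := fun δ => δ⁻¹ • (y (tstar + δ) - y tstar)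
  have hmem : tstar ∈ Icc tstar θ₀ := ⟨le_rfl, hts.2.le⟩
  have hsmall : ∀ r > 0, ∀ᶠ δ in (U : Filter ℝ), δ ∈ Ioo 0 r := fun r hr =>
    hUle (Ioo_mem_nhdsGT hr)
  have hIcc : ∀ δ ∈ Ioo 0 (θ₀ - tstar), tstar + δ ∈ Icc tstar θ₀ := fun δ hδ =>
    ⟨by linarith [hδ.1], by linarith [hδ.2]⟩
  have hpos : 0 < θ₀ - tstar := sub_pos.2 hts.2
  have hqK : ∀ᶠ δ in (U : Filter ℝ), q δ ∈ Metric.closedBall 0 (K : ℝ) := by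
    filter_upwards [hsmall _ hpos] with δ hδ
    have h1 := hK.dist_le_mul _ (hIcc δ hδ) _ hmem
    rw [dist_eq_norm, Real.dist_eq, add_sub_cancel_left, abs_of_pos hδ.1] at h1
    rw [mem_closedBall_zero_iff, norm_smul, norm_inv, Real.norm_of_nonneg hδ.1.le,
      inv_mul_le_iff₀ hδ.1, mul_comm]
    exact h1
  obtain ⟨w, -, hw⟩ :=
    (isCompact_closedBall (0 : EuclideanSpace ℝ (Fin n)) (K : ℝ)).ultrafilter_le_nhds' (U.map q) hqK
  have hqw : Tendsto q U (𝓝 w) := hw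
  refine ⟨w, ?_, Dhat_eq_zero_of_frequently ?_⟩
  · by_contra hwF
    have hts' : tstar ∈ Icc t₀ θ₀ := ⟨hts.1, hts.2.le⟩
    obtain ⟨l, c, hlc, hcw⟩ := geometric_hahn_banach_closed_point (hF.convex _ hts' (y tstar))
      (hF.closed _ hts' _) hwF
    obtain ⟨ρ, hρ, husc⟩ := hF.usc _ hts' _ l c hlc
    refine hcw.not_ge (le_of_tendsto ((l.continuous.tendsto w).comp hqw) ?_)
    have hK1 : (0 : ℝ) < K + 1 := by positivity
    filter_upwards [hsmall _ hpos, hsmall _ hρ, hsmall (ρ / (K + 1)) (by positivity)]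
      with δ hδ hδρ hδK
    have hsub : Icc tstar (tstar + δ) ⊆ Icc tstar θ₀ := Icc_subset_Icc_right (hIcc δ hδ).2
    have hder : ∀ᵐ t ∂volume.restrict (Icc tstar (tstar + δ)),
        deriv (fun s => l (y s)) t ≤ c := by
      filter_upwards [ae_restrict_of_ae_restrict_of_subset hsub hae,
        ae_restrict_mem measurableSet_Icc] with t ⟨v, hv, hvd⟩ ht
      have hd : HasDerivAt (fun s => l (y s)) (l v) t := l.hasFDerivAt.comp_hasDerivAt t hvd
      rw [hd.deriv]
      have htθ := hsub ht
      refine (husc t ⟨hts.1.trans htθ.1, htθ.2⟩ ?_ (y t) ?_ v hv).le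
      · rw [abs_of_nonneg (by linarith [ht.1])]
        linarith [ht.2, hδρ.2]
      · have h1 := hK.dist_le_mul _ htθ _ hmem
        rw [dist_eq_norm, Real.dist_eq, abs_of_nonneg (by linarith [ht.1])] at h1
        have h2 : (K : ℝ) * (t - tstar) ≤ K * δ := by
          gcongr
          linarith [ht.2]
        have h3 := (lt_div_iff₀ hK1).1 hδK.2
        linarith [hδ.1]
    have hlip : LipschitzOnWith (‖l‖₊ * K) (fun s => l (y s)) (Icc tstar (tstar + δ)) :=
      l.lipschitz.comp_lipschitzOnWith (hK.mono hsub)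
    have h1 := hlip.sub_le_of_ae_deriv_le (by linarith [hδ.1]) hder
    simp only [Function.comp_apply, q, map_smul, map_sub, smul_eq_mul]
    rw [inv_mul_le_iff₀ hδ.1]
    linarith
  · have h2 : Tendsto (fun δ => (δ, q δ)) U ((𝓝[>] (0 : ℝ)) ×ˢ 𝓝 w) :=
      Tendsto.prodMk hUle hqw
    refine h2.frequently (Eventually.frequently ?_)
    filter_upwards [hsmall _ hpos] with δ hδ
    have : y tstar + δ • q δ = y (tstar + δ) := by
      simp [q, smul_smul, mul_inv_cancel₀ hδ.1.ne']
    simp only [this]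
    exact hJ _ (hIcc δ hδ)

section Euler

variable {E D : Type*} [NormedAddCommGroup E] [NormedSpace ℝ E] [NormedAddCommGroup D]

/-- `z'` is obtained from `z` by an Euler step of length at most `ε` for the inclusion
`x' ∈ F(t, x)`, `j' = 0`, with errors of size `ε`. -/
def IsEulerStep (F : ℝ → E → Set E) (t₀ θ₀ ε : ℝ) (z z' : ℝ × E × D) : Prop :=
  z.1 < z'.1 ∧ z'.1 ≤ z.1 + ε ∧ ‖z'.2.2 - z.2.2‖ ≤ ε * (z'.1 - z.1) ∧
    ∃ s ∈ Icc t₀ θ₀, ∃ ξ, ∃ w ∈ F s ξ, |s - z.1| ≤ ε ∧ ‖ξ - z.2.1‖ ≤ ε ∧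
      ‖(z'.2.1 - z.2.1) - (z'.1 - z.1) • w‖ ≤ ε * (z'.1 - z.1)

theorem IsCompact.exists_uniform_isEulerStep {F : ℝ → E → Set E} {t₀ θ₀ ε : ℝ} (hε : 0 < ε)
    {G K : Set (ℝ × E × D)} (hK : IsCompact K) (hKt : ∀ z ∈ K, z.1 ∈ Icc t₀ θ₀)
    (hstep : ∀ z ∈ K, ∃ z' ∈ G, z.1 < z'.1 ∧ z'.1 < z.1 + ε ∧
      ‖z'.2.2 - z.2.2‖ < ε * (z'.1 - z.1) ∧
      ∃ w ∈ F z.1 z.2.1, ‖(z'.2.1 - z.2.1) - (z'.1 - z.1) • w‖ < ε * (z'.1 - z.1)) :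
    ∃ δ > 0, ∀ z ∈ K, ∃ z' ∈ G, IsEulerStep F t₀ θ₀ ε z z' ∧ z.1 + δ ≤ z'.1 := by
  refine hK.induction_on (p := fun S => ∃ δ > 0, ∀ z ∈ S, ∃ z' ∈ G,
    IsEulerStep F t₀ θ₀ ε z z' ∧ z.1 + δ ≤ z'.1) ⟨1, one_pos, by simp⟩ ?_ ?_ ?_
  · rintro s t hst ⟨δ, hδ, h⟩
    exact ⟨δ, hδ, fun z hz => h z (hst hz)⟩
  · rintro s t ⟨δ, hδ, h⟩ ⟨δ', hδ', h'⟩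
    refine ⟨min δ δ', lt_min hδ hδ', ?_⟩
    rintro z (hz | hz)
    · obtain ⟨z', hG, hs, hle⟩ := h z hz
      exact ⟨z', hG, hs, by linarith [min_le_left δ δ']⟩
    · obtain ⟨z', hG, hs, hle⟩ := h' z hz
      exact ⟨z', hG, hs, by linarith [min_le_right δ δ']⟩
  · intro y hy
    obtain ⟨z', hG, h1, h2, h3, w, hw, h4⟩ := hstep y hy
    refine ⟨{z | (y.1 + z'.1) / 2 < z'.1 ∧ z.1 < (y.1 + z'.1) / 2 ∧ z'.1 < z.1 + ε ∧
      ‖z'.2.2 - z.2.2‖ < ε * (z'.1 - z.1) ∧ |y.1 - z.1| < ε ∧ ‖y.2.1 - z.2.1‖ < ε ∧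
      ‖(z'.2.1 - z.2.1) - (z'.1 - z.1) • w‖ < ε * (z'.1 - z.1)}, mem_nhdsWithin_of_mem_nhds
        (IsOpen.mem_nhds ?_ ?_), z'.1 - (y.1 + z'.1) / 2, by linarith, ?_⟩
    · simp only [ofPred_and]
      refine isOpen_const.inter (IsOpen.inter ?_ (IsOpen.inter ?_ (IsOpen.inter ?_
        (IsOpen.inter ?_ (IsOpen.inter ?_ ?_))))) <;>
      exact isOpen_lt (by fun_prop) (by fun_prop)
    · exact ⟨by linarith, by linarith, h2, h3, by simpa, by simpa, h4⟩
    · rintro z ⟨-, g1, g2, g3, g4, g5, g6⟩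
      exact ⟨z', hG, ⟨by linarith, g2.le, g3.le, y.1, hKt y hy, y.2.1, w, hw, g4.le, g5.le, g6.le⟩,
        by linarith⟩

variable {F : ℝ → E → Set E} {t₀ θ₀ ε C : ℝ}

theorem IsEulerStep.norm_sub_le {z z' : ℝ × E × D} (hF : IsMarchaud F t₀ θ₀ C) (hε : ε ≤ 1)
    (h : IsEulerStep F t₀ θ₀ ε z z') :
    ‖z'.2.1 - z.2.1‖ ≤ (C * (2 + ‖z.2.1‖) + 1) * (z'.1 - z.1) := by
  obtain ⟨h1, -, -, s, hs, ξ, w, hw, -, hξ, h4⟩ := h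
  have hpos : 0 ≤ z'.1 - z.1 := by linarith
  have hξ' : ‖ξ‖ ≤ ‖z.2.1‖ + 1 := by
    have := norm_le_norm_add_norm_sub' ξ z.2.1
    linarith
  have hw' : ‖w‖ ≤ C * (2 + ‖z.2.1‖) := (hF.growth s hs ξ w hw).trans
    (mul_le_mul_of_nonneg_left (by linarith) hF.nonneg)
  calc ‖z'.2.1 - z.2.1‖ ≤ ‖(z'.1 - z.1) • w‖ + ‖(z'.2.1 - z.2.1) - (z'.1 - z.1) • w‖ :=
        norm_le_norm_add_norm_sub' _ _
    _ ≤ (z'.1 - z.1) * (C * (2 + ‖z.2.1‖)) + 1 * (z'.1 - z.1) := by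
        rw [norm_smul, Real.norm_of_nonneg hpos]
        gcongr
        exact h4.trans (mul_le_mul_of_nonneg_right hε hpos)
    _ = _ := by ring

/-- The growth estimate propagated along Euler steps. -/
theorem IsEulerStep.one_add_norm_le {z z' : ℝ × E × D} {t A : ℝ} (hF : IsMarchaud F t₀ θ₀ C)
    (hε : ε ≤ 1) (h : IsEulerStep F t₀ θ₀ ε z z')
    (hz : 1 + ‖z.2.1‖ ≤ A * Real.exp ((2 * C + 1) * (z.1 - t))) :
    1 + ‖z'.2.1‖ ≤ A * Real.exp ((2 * C + 1) * (z'.1 - t)) := by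
  have h1 := h.norm_sub_le hF hε
  have hlt := h.1
  have h2 := norm_le_norm_add_norm_sub' z'.2.1 z.2.1
  have hC := hF.nonneg
  have h3 := Real.add_one_le_exp ((2 * C + 1) * (z'.1 - z.1))
  have h4 : (C * (2 + ‖z.2.1‖) + 1) * (z'.1 - z.1)
      ≤ ((2 * C + 1) * (1 + ‖z.2.1‖)) * (z'.1 - z.1) := by
    refine mul_le_mul_of_nonneg_right ?_ (by linarith)
    nlinarith [norm_nonneg z.2.1, mul_nonneg hC (norm_nonneg z.2.1)]
  calc 1 + ‖z'.2.1‖ ≤ (1 + ‖z.2.1‖) * ((2 * C + 1) * (z'.1 - z.1) + 1) := by linarith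
    _ ≤ (A * Real.exp ((2 * C + 1) * (z.1 - t))) * Real.exp ((2 * C + 1) * (z'.1 - z.1)) := by
        gcongr
        exact (by positivity : 0 ≤ 1 + ‖z.2.1‖).trans hz
    _ = _ := by
        rw [mul_assoc, ← Real.exp_add]
        ring_nf

theorem monotone_fst_of_isEulerStep {z : ℕ → ℝ × E × D}
    (hz : ∀ k, z (k + 1) = z k ∨ IsEulerStep F t₀ θ₀ ε (z k) (z (k + 1))) :
    Monotone fun k => (z k).1 := by
  refine monotone_nat_of_le_succ fun k => ?_
  rcases hz k with h | h
  · rw [h]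
  · exact h.1.le

theorem norm_sub_le_of_isEulerStep {z : ℕ → ℝ × E × D}
    (hz : ∀ k, z (k + 1) = z k ∨ IsEulerStep F t₀ θ₀ ε (z k) (z (k + 1)))
    {R : ℝ} (hF : IsMarchaud F t₀ θ₀ C) (hε : ε ≤ 1)
    (hR : ∀ k, ‖(z k).2.1‖ ≤ R) {i j : ℕ} (hij : i ≤ j) :
    ‖(z j).2.1 - (z i).2.1‖ ≤ (C * (2 + R) + 1) * ((z j).1 - (z i).1) := by
  induction j, hij using Nat.le_induction with
  | base => simp
  | succ j hij ih =>
    rcases hz j with h | h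
    · rwa [h]
    · have h1 := h.norm_sub_le hF hε
      have h2 : (C * (2 + ‖(z j).2.1‖) + 1) * ((z (j + 1)).1 - (z j).1)
          ≤ (C * (2 + R) + 1) * ((z (j + 1)).1 - (z j).1) := by
        have := hF.nonneg
        have := h.1
        gcongr
        exact hR j
      have h3 := norm_sub_le_norm_sub_add_norm_sub (z (j + 1)).2.1 (z j).2.1 (z i).2.1
      linarith

theorem map_sub_le_of_isEulerStep {z : ℕ → ℝ × E × D}
    (hz : ∀ k, z (k + 1) = z k ∨ IsEulerStep F t₀ θ₀ ε (z k) (z (k + 1)))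
    (l : E →L[ℝ] ℝ) {c : ℝ} {i j : ℕ} (hij : i ≤ j)
    (hc : ∀ k, i ≤ k → k ≤ j → ∀ u ∈ Icc t₀ θ₀, ∀ ξ, |u - (z k).1| ≤ ε → ‖ξ - (z k).2.1‖ ≤ ε →
      ∀ w ∈ F u ξ, l w ≤ c) :
    l ((z j).2.1 - (z i).2.1) ≤ ((z j).1 - (z i).1) * (c + ‖l‖ * ε) := by
  induction j, hij using Nat.le_induction with
  | base => simp
  | succ j hij ih =>
    specialize ih fun k hik hkj => hc k hik (by omega)
    rcases hz j with h | h
    · rwa [h]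
    · obtain ⟨h1, -, -, s, hs, ξ, w, hw, g1, g2, g3⟩ := h
      have h2 := hc j hij (by omega) s hs ξ g1 g2 w hw
      have h3 : l ((z (j + 1)).2.1 - (z j).2.1 - ((z (j + 1)).1 - (z j).1) • w)
          ≤ ‖l‖ * (ε * ((z (j + 1)).1 - (z j).1)) :=
        (le_abs_self _).trans ((l.le_opNorm _).trans (mul_le_mul_of_nonneg_left g3 (norm_nonneg _)))
      have h4 : ((z (j + 1)).1 - (z j).1) * l w ≤ ((z (j + 1)).1 - (z j).1) * c :=
        mul_le_mul_of_nonneg_left h2 (by linarith)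
      simp only [map_sub, map_smul, smul_eq_mul] at h3 ih ⊢
      linarith

theorem exists_fst_le_of_isEulerStep {z : ℕ → ℝ × E × D}
    (hz : ∀ k, z (k + 1) = z k ∨ IsEulerStep F t₀ θ₀ ε (z k) (z (k + 1)))
    (N : ℕ) {t : ℝ} (ht : (z 0).1 ≤ t)
    (htN : t ≤ (z N).1 + ε) : ∃ k, (z k).1 ≤ t ∧ t ≤ (z k).1 + ε := by
  induction N with
  | zero => exact ⟨0, ht, htN⟩
  | succ N ih =>
    by_cases h : t ≤ (z N).1 + ε
    · exact ih h
    · refine ⟨N + 1, ?_, htN⟩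
      rcases hz N with h' | h'
      · rw [h'] at htN
        exact absurd htN h
      · exact h'.2.1.trans (not_le.1 h).le

/-- Euler chains issued from a point of a closed set all of whose points admit Euler steps. -/
theorem exists_isEulerStep_chain [ProperSpace E] [ProperSpace D] (hF : IsMarchaud F t₀ θ₀ C)
    (hε0 : 0 < ε) (hε1 : ε ≤ 1) {G : Set (ℝ × E × D)} (hG : IsClosed G)
    (hGt : ∀ z ∈ G, z.1 ∈ Icc t₀ θ₀)
    (hstep : ∀ z ∈ G, z.1 < θ₀ → ∃ z' ∈ G, z.1 < z'.1 ∧ z'.1 < z.1 + ε ∧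
      ‖z'.2.2 - z.2.2‖ < ε * (z'.1 - z.1) ∧
      ∃ w ∈ F z.1 z.2.1, ‖(z'.2.1 - z.2.1) - (z'.1 - z.1) • w‖ < ε * (z'.1 - z.1))
    {z₀ : ℝ × E × D} (hz₀ : z₀ ∈ G) :
    ∃ z : ℕ → ℝ × E × D, z 0 = z₀ ∧
      (∀ k, z (k + 1) = z k ∨ IsEulerStep F t₀ θ₀ ε (z k) (z (k + 1))) ∧
      (∀ k, z k ∈ G ∧ ‖(z k).2.1‖ ≤ (1 + ‖z₀.2.1‖) * Real.exp ((2 * C + 1) * (θ₀ - z₀.1)) ∧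
        ‖(z k).2.2 - z₀.2.2‖ ≤ ε * (θ₀ - z₀.1)) ∧ ∃ N, θ₀ ≤ (z N).1 + ε := by
  set R := (1 + ‖z₀.2.1‖) * Real.exp ((2 * C + 1) * (θ₀ - z₀.1)) with hR
  have hC := hF.nonneg
  let K := G ∩ (Icc t₀ (θ₀ - ε) ×ˢ Metric.closedBall 0 R ×ˢ Metric.closedBall z₀.2.2 (θ₀ - z₀.1))
  have hK : IsCompact K := (isCompact_Icc.prod
    ((isCompact_closedBall _ _).prod (isCompact_closedBall _ _))).inter_left hG
  obtain ⟨δ, hδ, hnext⟩ := hK.exists_uniform_isEulerStep hε0 (fun z hz => hGt z hz.1)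
    (fun z hz => hstep z hz.1 (by have := hz.2.1.2; linarith))
  have hnext' : ∀ z, ∃ z', (z ∈ K → z' ∈ G ∧ IsEulerStep F t₀ θ₀ ε z z' ∧ z.1 + δ ≤ z'.1) ∧
      (z ∉ K → z' = z) := fun z => by
    by_cases h : z ∈ K
    · obtain ⟨z', h'⟩ := hnext z h
      exact ⟨z', fun _ => h', fun h'' => absurd h h''⟩
    · exact ⟨z, fun h' => absurd h' h, fun _ => rfl⟩
  choose next hnextK hnextN using hnext'
  let z : ℕ → ℝ × E × D := fun k => next^[k] z₀
  have hzs : ∀ k, z (k + 1) = next (z k) := fun k => Function.iterate_succ_apply' _ _ _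
  have hinv : ∀ k, z k ∈ G ∧ z₀.1 ≤ (z k).1 ∧
      1 + ‖(z k).2.1‖ ≤ (1 + ‖z₀.2.1‖) * Real.exp ((2 * C + 1) * ((z k).1 - z₀.1)) ∧
      ‖(z k).2.2 - z₀.2.2‖ ≤ ε * ((z k).1 - z₀.1) := by
    intro k
    induction k with
    | zero => exact ⟨hz₀, le_rfl, by simp [z], by simp [z]⟩
    | succ k ih =>
      rw [hzs]
      by_cases h : z k ∈ K
      · obtain ⟨h1, h2, -⟩ := hnextK _ h
        refine ⟨h1, ih.2.1.trans h2.1.le, h2.one_add_norm_le hF hε1 ih.2.2.1, ?_⟩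
        have h3 := norm_sub_le_norm_sub_add_norm_sub (next (z k)).2.2 (z k).2.2 z₀.2.2
        have h4 := h2.2.2.1
        linarith [ih.2.2.2]
      · rwa [hnextN _ h]
  have hbd : ∀ k, z k ∈ G ∧ ‖(z k).2.1‖ ≤ R ∧ ‖(z k).2.2 - z₀.2.2‖ ≤ ε * (θ₀ - z₀.1) := by
    intro k
    obtain ⟨h1, -, h3, h4⟩ := hinv k
    have h5 := (hGt _ h1).2
    refine ⟨h1, ?_, h4.trans (by gcongr)⟩
    have : (1 + ‖z₀.2.1‖) * Real.exp ((2 * C + 1) * ((z k).1 - z₀.1)) ≤ R := by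
      rw [hR]
      gcongr
    linarith
  refine ⟨z, rfl, fun k => ?_, hbd, ?_⟩
  · rw [hzs]
    by_cases h : z k ∈ K
    · exact Or.inr (hnextK _ h).2.1
    · exact Or.inl (hnextN _ h)
  · by_contra! hcon
    have hmem : ∀ k, z k ∈ K := fun k => by
      obtain ⟨h1, h2, h3⟩ := hbd k
      refine ⟨h1, ⟨(hGt _ h1).1, by linarith [hcon k]⟩, by simpa using h2, ?_⟩
      rw [mem_closedBall_iff_norm]
      have : 0 ≤ θ₀ - z₀.1 := sub_nonneg.2 (hGt _ hz₀).2
      nlinarith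
    have hgrow : ∀ k : ℕ, z₀.1 + k * δ ≤ (z k).1 := fun k => by
      induction k with
      | zero => simp [z]
      | succ k ih =>
        have := (hnextK _ (hmem k)).2.2
        rw [hzs]
        push_cast
        linarith
    obtain ⟨k, hk⟩ := exists_nat_gt ((θ₀ - z₀.1) / δ)
    rw [div_lt_iff₀ hδ] at hk
    linarith [hgrow k, hcon k]

/-- Euler arcs: step functions whose nodes lie in `G`, with increments controlled by `F`. -/
theorem exists_euler_arc [ProperSpace E] [ProperSpace D] (hF : IsMarchaud F t₀ θ₀ C)
    (hε0 : 0 < ε) (hε1 : ε ≤ 1) {G : Set (ℝ × E × D)} (hG : IsClosed G)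
    (hGt : ∀ z ∈ G, z.1 ∈ Icc t₀ θ₀)
    (hstep : ∀ z ∈ G, z.1 < θ₀ → ∃ z' ∈ G, z.1 < z'.1 ∧ z'.1 < z.1 + ε ∧
      ‖z'.2.2 - z.2.2‖ < ε * (z'.1 - z.1) ∧
      ∃ w ∈ F z.1 z.2.1, ‖(z'.2.1 - z.2.1) - (z'.1 - z.1) • w‖ < ε * (z'.1 - z.1))
    {z₀ : ℝ × E × D} (hz₀ : z₀ ∈ G) {R M : ℝ}
    (hR : R = (1 + ‖z₀.2.1‖) * Real.exp ((2 * C + 1) * (θ₀ - z₀.1)))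
    (hM : M = C * (2 + R) + 1) :
    ∃ a : ℝ → ℝ × E × D,
      (∀ t ∈ Icc z₀.1 θ₀, a t ∈ G ∧ (a t).1 ≤ t ∧ t ≤ (a t).1 + ε ∧ ‖(a t).2.1‖ ≤ R ∧
        ‖(a t).2.2 - z₀.2.2‖ ≤ ε * (θ₀ - z₀.1)) ∧
      ‖(a z₀.1).2.1 - z₀.2.1‖ ≤ M * ε ∧
      ∀ s ∈ Icc z₀.1 θ₀, ∀ r ∈ Icc z₀.1 θ₀, s + ε < r →
        ‖(a r).2.1 - (a s).2.1‖ ≤ M * ((a r).1 - (a s).1) ∧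
        ∀ (l : E →L[ℝ] ℝ) (c : ℝ), (∀ u ∈ Icc t₀ θ₀, ∀ ξ, |u - s| ≤ r - s + 2 * ε →
          ‖ξ - (a s).2.1‖ ≤ M * (r - s + ε) + ε → ∀ w ∈ F u ξ, l w ≤ c) →
        l ((a r).2.1 - (a s).2.1) ≤ ((a r).1 - (a s).1) * (c + ‖l‖ * ε) := by
  obtain ⟨z, hz0, hzs, hzb, N, hN⟩ := exists_isEulerStep_chain hF hε0 hε1 hG hGt hstep hz₀
  rw [← hR] at hzb
  have hmono := monotone_fst_of_isEulerStep hzs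
  have hnorm := fun {i j : ℕ} (hij : i ≤ j) =>
    norm_sub_le_of_isEulerStep hzs hF hε1 (fun k => (hzb k).2.1) hij
  rw [← hM] at hnorm
  have hR0 : 0 ≤ R := by
    rw [hR]
    positivity
  have hM0 : 0 ≤ M := by
    have := hF.nonneg
    rw [hM]
    positivity
  have hcov : ∀ t, ∃ k, t ∈ Icc z₀.1 θ₀ → (z k).1 ≤ t ∧ t ≤ (z k).1 + ε := fun t => by
    by_cases ht : t ∈ Icc z₀.1 θ₀
    · obtain ⟨k, hk⟩ := exists_fst_le_of_isEulerStep hzs N (t := t) (by rw [hz0]; exact ht.1)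
        (ht.2.trans hN)
      exact ⟨k, fun _ => hk⟩
    · exact ⟨0, fun h => absurd h ht⟩
  choose κ hκ using hcov
  refine ⟨fun t => z (κ t), fun t ht => ⟨(hzb _).1, (hκ t ht).1, (hκ t ht).2, (hzb _).2⟩, ?_, ?_⟩
  · have hmem : z₀.1 ∈ Icc z₀.1 θ₀ := ⟨le_rfl, (hGt _ hz₀).2⟩
    have h1 := hnorm (Nat.zero_le (κ z₀.1))
    rw [hz0] at h1
    exact h1.trans (mul_le_mul_of_nonneg_left (by linarith [(hκ _ hmem).1]) hM0)
  · intro s hs r hr hsr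
    have hle : κ s ≤ κ r := by
      by_contra! h
      have := hmono h.le
      simp only at this
      linarith [(hκ s hs).1, (hκ r hr).2]
    refine ⟨hnorm hle, fun l c hc => ?_⟩
    refine map_sub_le_of_isEulerStep hzs l hle fun k hk1 hk2 u hu ξ huk hξk w hw => ?_
    have h1 : (z (κ s)).1 ≤ (z k).1 := hmono hk1
    have h2 : (z k).1 ≤ (z (κ r)).1 := hmono hk2
    have h3 := hκ s hs
    have h4 := hκ r hr
    refine hc u hu ξ ?_ ?_ w hw
    · rw [abs_le] at huk ⊢
      constructor <;> linarith
    · have h5 := norm_sub_le_norm_sub_add_norm_sub ξ (z k).2.1 (z (κ s)).2.1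
      have h6 := (hnorm hk1).trans (mul_le_mul_of_nonneg_left
        (show (z k).1 - (z (κ s)).1 ≤ r - s + ε by linarith) hM0)
      linarith

/-- Limits of Euler arcs: Lipschitz arcs in a closed set whose increments are controlled by `F`. -/
theorem exists_lipschitz_arc [ProperSpace E] [ProperSpace D] (hF : IsMarchaud F t₀ θ₀ C)
    {G : Set (ℝ × E × D)} (hG : IsClosed G) (hGt : ∀ z ∈ G, z.1 ∈ Icc t₀ θ₀)
    (hstep : ∀ ε > 0, ∀ z ∈ G, z.1 < θ₀ → ∃ z' ∈ G, z.1 < z'.1 ∧ z'.1 < z.1 + ε ∧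
      ‖z'.2.2 - z.2.2‖ < ε * (z'.1 - z.1) ∧
      ∃ w ∈ F z.1 z.2.1, ‖(z'.2.1 - z.2.1) - (z'.1 - z.1) • w‖ < ε * (z'.1 - z.1))
    {z₀ : ℝ × E × D} (hz₀ : z₀ ∈ G) :
    ∃ (y : ℝ → E) (M : ℝ≥0), LipschitzOnWith M y (Icc z₀.1 θ₀) ∧ y z₀.1 = z₀.2.1 ∧
      (∀ t ∈ Icc z₀.1 θ₀, (t, y t, z₀.2.2) ∈ G) ∧
      ∀ s ∈ Icc z₀.1 θ₀, ∀ r ∈ Icc z₀.1 θ₀, s < r → ∀ (l : E →L[ℝ] ℝ) (c : ℝ), ∀ ρ > 0,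
        (∀ u ∈ Icc t₀ θ₀, ∀ ξ, |u - s| ≤ r - s + ρ → ‖ξ - y s‖ ≤ M * (r - s) + ρ →
          ∀ w ∈ F u ξ, l w ≤ c) → l (y r - y s) ≤ (r - s) * c := by
  obtain ⟨R, hR⟩ : ∃ R, R = (1 + ‖z₀.2.1‖) * Real.exp ((2 * C + 1) * (θ₀ - z₀.1)) := ⟨_, rfl⟩
  obtain ⟨M, hM⟩ : ∃ M, M = C * (2 + R) + 1 := ⟨_, rfl⟩
  have hR0 : 0 ≤ R := by
    rw [hR]
    positivity
  have hM0 : 0 ≤ M := by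
    have := hF.nonneg
    rw [hM]
    positivity
  lift M to ℝ≥0 using hM0
  have hle : z₀.1 ≤ θ₀ := (hGt _ hz₀).2
  let ε : ℕ → ℝ := fun m => 1 / ((m : ℝ) + 1)
  have hε0 : ∀ m, 0 < ε m := fun m => Nat.one_div_pos_of_nat
  have hε1 : ∀ m, ε m ≤ 1 := fun m => by
    rw [div_le_one (by positivity)]
    linarith [Nat.cast_nonneg (α := ℝ) m]
  choose a ha1 ha2 ha3 using fun m => exists_euler_arc hF (hε0 m) (hε1 m) hG hGt
    (hstep (ε m) (hε0 m)) hz₀ hR hM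
  let U : Ultrafilter ℕ := hyperfilter ℕ
  have hεU : Tendsto ε U (𝓝 0) :=
    tendsto_one_div_add_atTop_nhds_zero_nat.mono_left Nat.hyperfilter_le_atTop
  have hlim : ∀ t, ∃ y, t ∈ Icc z₀.1 θ₀ → Tendsto (fun m => (a m t).2.1) U (𝓝 y) := fun t => by
    by_cases ht : t ∈ Icc z₀.1 θ₀
    · obtain ⟨y, -, hy⟩ := (isCompact_closedBall (0 : E) R).ultrafilter_le_nhds'
        (U.map fun m => (a m t).2.1) (Eventually.of_forall (f := (U : Filter ℕ)) fun m => by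
          simpa using (ha1 m t ht).2.2.2.1)
      exact ⟨y, fun _ => hy⟩
    · exact ⟨0, fun h => absurd h ht⟩
  choose y hy using hlim
  have hτ : ∀ t ∈ Icc z₀.1 θ₀, Tendsto (fun m => (a m t).1) U (𝓝 t) := fun t ht => by
    refine tendsto_of_tendsto_of_tendsto_of_le_of_le (g := fun m => t - ε m) (h := fun _ => t)
      (by simpa using tendsto_const_nhds.sub hεU) tendsto_const_nhds (fun m => ?_) fun m => ?_
    · have := (ha1 m t ht).2.2.1
      simp only
      linarith
    · exact (ha1 m t ht).2.1
  have hJ : ∀ t ∈ Icc z₀.1 θ₀, Tendsto (fun m => (a m t).2.2) U (𝓝 z₀.2.2) := fun t ht => by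
    rw [tendsto_iff_norm_sub_tendsto_zero]
    exact squeeze_zero (fun _ => norm_nonneg _) (fun m => (ha1 m t ht).2.2.2.2)
      (by simpa using hεU.mul_const (θ₀ - z₀.1))
  have hlt : ∀ r > 0, ∀ᶠ m in (U : Filter ℕ), ε m < r := fun r hr =>
    hεU.eventually (gt_mem_nhds hr)
  have hlip : ∀ s ∈ Icc z₀.1 θ₀, ∀ r ∈ Icc z₀.1 θ₀, s < r → ‖y r - y s‖ ≤ M * (r - s) := by
    intro s hs r hr hsr
    refine le_of_tendsto_of_tendsto ((hy r hr).sub (hy s hs)).norm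
      (((hτ r hr).sub (hτ s hs)).const_mul (M : ℝ)) ?_
    filter_upwards [hlt (r - s) (by linarith)] with m hm
    exact (ha3 m s hs r hr (by linarith)).1
  refine ⟨y, M, ?_, ?_, ?_, ?_⟩
  · refine LipschitzOnWith.of_dist_le_mul fun s hs r hr => ?_
    rw [dist_eq_norm, Real.dist_eq]
    rcases lt_trichotomy s r with h | rfl | h
    · rw [norm_sub_rev, abs_sub_comm, abs_of_pos (by linarith)]
      exact hlip s hs r hr h
    · simp
    · rw [abs_of_pos (by linarith)]
      exact hlip r hr s hs h
  · have hmem : z₀.1 ∈ Icc z₀.1 θ₀ := ⟨le_rfl, hle⟩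
    refine tendsto_nhds_unique (hy _ hmem) ?_
    rw [tendsto_iff_norm_sub_tendsto_zero]
    exact squeeze_zero (fun _ => norm_nonneg _) ha2 (by simpa using hεU.const_mul (M : ℝ))
  · intro t ht
    exact hG.mem_of_tendsto ((hτ t ht).prodMk_nhds ((hy t ht).prodMk_nhds (hJ t ht)))
      (Eventually.of_forall fun m => (ha1 m t ht).1)
  · intro s hs r hr hsr l c ρ hρ hc
    have hlim2 : Tendsto (fun m => ((a m r).1 - (a m s).1) * (c + ‖l‖ * ε m)) U
        (𝓝 ((r - s) * (c + ‖l‖ * 0))) :=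
      ((hτ r hr).sub (hτ s hs)).mul (tendsto_const_nhds.add (hεU.const_mul _))
    rw [mul_zero, add_zero] at hlim2
    refine le_of_tendsto_of_tendsto ((l.continuous.tendsto _).comp ((hy r hr).sub (hy s hs)))
      hlim2 ?_
    have herr : Tendsto (fun m => ‖(a m s).2.1 - y s‖ + (M * ε m + ε m)) U (𝓝 (0 + (M * 0 + 0))) :=
      (tendsto_iff_norm_sub_tendsto_zero.1 (hy s hs)).add ((hεU.const_mul (M : ℝ)).add hεU)
    filter_upwards [hlt (r - s) (by linarith), hlt (ρ / 2) (by linarith),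
      herr.eventually (gt_mem_nhds (show 0 + (M * 0 + 0) < ρ by simpa using hρ))] with m h1 h2 h3
    refine (ha3 m s hs r hr (by linarith)).2 l c fun u hu ξ hus hξ => hc u hu ξ (by linarith) ?_
    have h4 := norm_sub_le_norm_sub_add_norm_sub ξ (a m s).2.1 (y s)
    linarith

theorem mem_of_hasDerivAt_of_increment_le (hF : IsMarchaud F t₀ θ₀ C) {y : ℝ → E} {M : ℝ≥0}
    {t b : ℝ} (ht : t ∈ Icc t₀ θ₀) (htb : t < b)
    (hinc : ∀ r ∈ Ioc t b, ∀ (l : E →L[ℝ] ℝ) (c : ℝ), ∀ ρ > 0,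
      (∀ u ∈ Icc t₀ θ₀, ∀ ξ, |u - t| ≤ r - t + ρ → ‖ξ - y t‖ ≤ M * (r - t) + ρ →
        ∀ w ∈ F u ξ, l w ≤ c) → l (y r - y t) ≤ (r - t) * c)
    {v : E} (hv : HasDerivAt y v t) : v ∈ F t (y t) := by
  by_contra hvF
  obtain ⟨l, c, hlc, hcv⟩ := geometric_hahn_banach_closed_point (hF.convex _ ht (y t))
    (hF.closed _ ht _) hvF
  obtain ⟨ρ, hρ, husc⟩ := hF.usc _ ht _ l c hlc
  refine hcv.not_ge (le_of_tendsto
    ((l.continuous.tendsto v).comp hv.tendsto_slope_zero_right) ?_)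
  have hM1 : (0 : ℝ) < M + 1 := by positivity
  filter_upwards [Ioo_mem_nhdsGT (sub_pos.2 htb),
    Ioo_mem_nhdsGT (show 0 < ρ / 2 / (M + 1) by positivity)] with h hh hhM
  have h3 := (lt_div_iff₀ hM1).1 hhM.2
  have h4 : 0 ≤ (M : ℝ) * h := mul_nonneg M.2 hh.1.le
  have h1 := hinc (t + h) ⟨by linarith [hh.1], by linarith [hh.2]⟩ l c (ρ / 2) (by linarith)
    fun u hu ξ hut hξ w hw => by
      rw [add_sub_cancel_left] at hut hξ
      exact (husc u hu (by linarith [hh.1]) ξ (by linarith [hh.1]) w hw).le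
  rw [add_sub_cancel_left] at h1
  rw [Function.comp_apply, map_smul, smul_eq_mul, inv_mul_le_iff₀ hh.1]
  exact h1

end Euler

theorem exists_isSol_of_euler_steps {n : ℕ} {t₀ θ₀ C : ℝ} {D : Type*} [NormedAddCommGroup D]
    [ProperSpace D] {F : ℝ → EuclideanSpace ℝ (Fin n) → Set (EuclideanSpace ℝ (Fin n))}
    (hF : IsMarchaud F t₀ θ₀ C) {G : Set (ℝ × EuclideanSpace ℝ (Fin n) × D)} (hG : IsClosed G)
    (hGt : ∀ z ∈ G, z.1 ∈ Icc t₀ θ₀)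
    (hstep : ∀ ε > 0, ∀ z ∈ G, z.1 < θ₀ → ∃ z' ∈ G, z.1 < z'.1 ∧ z'.1 < z.1 + ε ∧
      ‖z'.2.2 - z.2.2‖ < ε * (z'.1 - z.1) ∧
      ∃ w ∈ F z.1 z.2.1, ‖(z'.2.1 - z.2.1) - (z'.1 - z.1) • w‖ < ε * (z'.1 - z.1))
    {z₀ : ℝ × EuclideanSpace ℝ (Fin n) × D} (hz₀ : z₀ ∈ G) :
    ∃ y, IsSol F θ₀ z₀.1 z₀.2.1 y ∧ ∀ t ∈ Icc z₀.1 θ₀, (t, y t, z₀.2.2) ∈ G := by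
  obtain ⟨y, M, hlip, hy0, hyG, hinc⟩ := exists_lipschitz_arc hF hG hGt hstep hz₀
  refine ⟨y, ⟨⟨M, hlip⟩, hy0, ?_⟩, hyG⟩
  have hne : ∀ a : ℝ, ∀ᵐ t ∂volume.restrict (Icc z₀.1 θ₀), t ≠ a := fun a =>
    ae_restrict_of_ae (Measure.ae_ne volume a)
  filter_upwards [hlip.ae_differentiableWithinAt_real measurableSet_Icc,
    ae_restrict_mem measurableSet_Icc, hne z₀.1, hne θ₀] with t hd ht h1 h2
  have hlt1 : z₀.1 < t := lt_of_le_of_ne ht.1 (Ne.symm h1)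
  have hlt2 : t < θ₀ := lt_of_le_of_ne ht.2 h2
  have hderiv := (hd.differentiableAt (Icc_mem_nhds hlt1 hlt2)).hasDerivAt
  exact ⟨_, mem_of_hasDerivAt_of_increment_le hF ⟨(hGt _ hz₀).1.trans ht.1, ht.2⟩ hlt2
    (fun r hr => hinc t ht r ⟨ht.1.trans hr.1.le, hr.2⟩ hr.1) hderiv, hderiv⟩

/-- A vanishing directional derivative produces arbitrarily short Euler steps in the graph. -/
theorem exists_euler_step_of_iInf_Dhat_eq_zero {E : Type*} [NormedAddCommGroup E]
    [NormedSpace ℝ E] {T : ℝ → E → Set (ℝ × ℝ)} {t θ₀ : ℝ} {x : E} {J : ℝ × ℝ} {V : Set E}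
    (ht : t < θ₀) (h : ⨅ w ∈ V, Dhat T t x J w = 0) {ε : ℝ} (hε : 0 < ε) :
    ∃ t' x' J', t' ≤ θ₀ ∧ J' ∈ T t' x' ∧ t < t' ∧ t' < t + ε ∧ ‖J' - J‖ < ε * (t' - t) ∧
      ∃ w ∈ V, ‖(x' - x) - (t' - t) • w‖ < ε * (t' - t) := by
  have hlt : ⨅ w ∈ V, Dhat T t x J w < ENNReal.ofReal ε := by
    rw [h]
    exact ENNReal.ofReal_pos.2 hε
  simp only [iInf_lt_iff, exists_prop] at hlt
  obtain ⟨w, hw, hwlt⟩ := hlt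
  have hfreq := frequently_lt_of_liminf_lt (h := hwlt)
  have hev : ∀ᶠ p : ℝ × E in (𝓝[>] (0 : ℝ)) ×ˢ 𝓝 w,
      p.1 ∈ Ioo 0 (min ε (θ₀ - t)) ∧ p.2 ∈ Metric.ball w ε :=
    prod_mem_prod (Ioo_mem_nhdsGT (lt_min hε (sub_pos.2 ht))) (Metric.ball_mem_nhds w hε)
  obtain ⟨⟨δ, w'⟩, hp, ⟨hδ0, hδ⟩, hw'⟩ := (hfreq.and_eventually hev).exists
  simp only at hp hδ0 hδ hw'
  rw [ENNReal.div_lt_iff (Or.inl (ENNReal.ofReal_pos.2 hδ0).ne') (Or.inl ENNReal.ofReal_ne_top),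
    ← ENNReal.ofReal_mul hε.le, pdist] at hp
  simp only [iInf_lt_iff, exists_prop] at hp
  obtain ⟨ζ, hζ, hlt⟩ := hp
  rw [ENNReal.ofReal_lt_ofReal_iff (mul_pos hε hδ0)] at hlt
  have h1 := hδ.trans_le (min_le_left _ _)
  have h2 := hδ.trans_le (min_le_right _ _)
  refine ⟨t + δ, x + δ • w', ζ, by linarith, hζ, by linarith, by linarith, ?_, w, hw, ?_⟩
  · rw [add_sub_cancel_left]
    refine lt_of_le_of_lt ?_ hlt
    rw [Prod.norm_def]
    exact max_le (le_add_of_nonneg_right (abs_nonneg _)) (le_add_of_nonneg_left (abs_nonneg _))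
  · rw [add_sub_cancel_left, add_sub_cancel_left, ← smul_sub, norm_smul,
      Real.norm_of_nonneg hδ0.le, mul_comm ε]
    exact mul_lt_mul_of_pos_left (by rwa [← dist_eq_norm]) hδ0

/-- Theorem 2 (Theorem `th_infinitizemal`): for a closed multivalued map `T` with nonempty
compact values, condition (N3) is equivalent to the infinitesimal condition
`sup_{(J₁,J₂) ∈ T(t*,x*)} inf_{w ∈ F(t*,x*)} D̂T(t*,x*;(J₁,J₂),w) = 0`. -/
theorem condN3_iff_directional_derivative
    {n p q : ℕ} (t₀ θ₀ : ℝ) (ht : t₀ < θ₀)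
    (P : Set (EuclideanSpace ℝ (Fin p))) (Q : Set (EuclideanSpace ℝ (Fin q)))
    (hPne : P.Nonempty) (hPc : IsCompact P) (hQne : Q.Nonempty) (hQc : IsCompact Q)
    (f : ℝ → EuclideanSpace ℝ (Fin n) → EuclideanSpace ℝ (Fin p) → EuclideanSpace ℝ (Fin q) →
      EuclideanSpace ℝ (Fin n))
    (hf_cont : ContinuousOn
      (fun z : ℝ × EuclideanSpace ℝ (Fin n) × EuclideanSpace ℝ (Fin p) × EuclideanSpace ℝ (Fin q) =>
        f z.1 z.2.1 z.2.2.1 z.2.2.2)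
      (Icc t₀ θ₀ ×ˢ (univ : Set (EuclideanSpace ℝ (Fin n))) ×ˢ P ×ˢ Q))
    (hf_lip : ∃ L : ℝ, ∀ t ∈ Icc t₀ θ₀, ∀ u ∈ P, ∀ v ∈ Q,
      ∀ x x' : EuclideanSpace ℝ (Fin n), ‖f t x u v - f t x' u v‖ ≤ L * ‖x - x'‖)
    (hf_growth : ∃ C : ℝ, ∀ t ∈ Icc t₀ θ₀, ∀ u ∈ P, ∀ v ∈ Q,
      ∀ x : EuclideanSpace ℝ (Fin n), ‖f t x u v‖ ≤ C * (1 + ‖x‖))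
    (T : ℝ → EuclideanSpace ℝ (Fin n) → Set (ℝ × ℝ))
    (hT_closed : IsClosed {z : ℝ × EuclideanSpace ℝ (Fin n) × (ℝ × ℝ) |
      z.1 ∈ Icc t₀ θ₀ ∧ z.2.2 ∈ T z.1 z.2.1})
    (hT_ne : ∀ t ∈ Icc t₀ θ₀, ∀ x : EuclideanSpace ℝ (Fin n), (T t x).Nonempty)
    (hT_cpt : ∀ t ∈ Icc t₀ θ₀, ∀ x : EuclideanSpace ℝ (Fin n), IsCompact (T t x)) :
    CondN3 t₀ θ₀ (velSet f P Q) T ↔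
      (∀ tstar ∈ Ico t₀ θ₀, ∀ xstar : EuclideanSpace ℝ (Fin n),
        (⨆ J ∈ T tstar xstar, ⨅ w ∈ velSet f P Q tstar xstar,
          Dhat T tstar xstar J w) = 0) := by
  obtain ⟨C, hC⟩ := hf_growth
  have hF : IsMarchaud (velSet f P Q) t₀ θ₀ (max C 0) :=
    velSet_isMarchaud hPc hQc hf_cont (fun t ht u hu v hv x => (hC t ht u hu v hv x).trans
      (mul_le_mul_of_nonneg_right (le_max_left _ _) (by positivity))) (le_max_right _ _)
  constructor
  · intro hN t hts x
    refine le_antisymm (iSup₂_le fun J hJ => ?_) bot_le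
    obtain ⟨y, hy, hyT⟩ := hN t ⟨hts.1, hts.2.le⟩ x J hJ
    obtain ⟨w, hw, hD⟩ := exists_Dhat_eq_zero_of_isSol hF hts hy hyT
    exact (iInf₂_le w hw).trans hD.le
  · intro hD t hts x J hJ
    have hstep : ∀ ε > 0, ∀ z ∈ {z : ℝ × EuclideanSpace ℝ (Fin n) × (ℝ × ℝ) |
        z.1 ∈ Icc t₀ θ₀ ∧ z.2.2 ∈ T z.1 z.2.1}, z.1 < θ₀ →
        ∃ z' ∈ {z : ℝ × EuclideanSpace ℝ (Fin n) × (ℝ × ℝ) |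
          z.1 ∈ Icc t₀ θ₀ ∧ z.2.2 ∈ T z.1 z.2.1}, z.1 < z'.1 ∧ z'.1 < z.1 + ε ∧
          ‖z'.2.2 - z.2.2‖ < ε * (z'.1 - z.1) ∧ ∃ w ∈ velSet f P Q z.1 z.2.1,
            ‖(z'.2.1 - z.2.1) - (z'.1 - z.1) • w‖ < ε * (z'.1 - z.1) := by
      rintro ε hε ⟨s, ξ, I⟩ ⟨hs, hI⟩ hsθ
      have hzero : ⨅ w ∈ velSet f P Q s ξ, Dhat T s ξ I w = 0 :=
        le_antisymm ((le_iSup₂ (f := fun I (_ : I ∈ T s ξ) =>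
          ⨅ w ∈ velSet f P Q s ξ, Dhat T s ξ I w) I hI).trans (hD s ⟨hs.1, hsθ⟩ ξ).le) bot_le
      obtain ⟨t', x', J', h1, h2, h3, h4⟩ := exists_euler_step_of_iInf_Dhat_eq_zero hsθ hzero hε
      exact ⟨(t', x', J'), ⟨⟨hs.1.trans h3.le, h1⟩, h2⟩, h3, h4⟩
    obtain ⟨y, hy, hyT⟩ := exists_isSol_of_euler_steps hF hT_closed (fun z hz => hz.1) hstep
      (z₀ := (t, x, J)) ⟨hts, hJ⟩
    exact ⟨y, hy, fun s hs => (hyT s hs).2⟩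
end
end

section
/- Let T : [t₀,θ₀]×ℝⁿ → 𝒫(ℝ²) be a set-valued map with nonempty compact values, and for s ∈ [t₀,θ₀] let G[s] := {(x,J₁,J₂) ∈ ℝⁿ×ℝ² : (J₁,J₂) ∈ T(s,x)} be the time-s section of its graph. Then for every (t,x) ∈ [t₀,θ₀)×ℝⁿ, every (J₁,J₂) ∈ T(t,x) and every w ∈ ℝⁿ, the following are equivalent: (i) D̂T(t,x;(J₁,J₂),w) = 0; (ii) liminf over δ↓0 of d((x+δw, J₁, J₂), G[t+δ])/δ = 0, where d denotes the Euclidean distance in ℝⁿ×ℝ² from a point to a set (distance to the empty set being +∞). -/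
open Set Filter
open scoped ENNReal NNReal Topology

noncomputable section

/-- The Euclidean distance in `ℝⁿ × ℝ²` from the point `(x, J₁, J₂)` to the set `G`
(equal to `+∞` when `G = ∅`). -/
def eucDist {n : ℕ} (x : EuclideanSpace ℝ (Fin n)) (J : ℝ × ℝ)
    (G : Set (EuclideanSpace ℝ (Fin n) × ℝ × ℝ)) : ℝ≥0∞ :=
  ⨅ g ∈ G, ENNReal.ofReal
    (Real.sqrt (‖x - g.1‖ ^ 2 + (J.1 - g.2.1) ^ 2 + (J.2 - g.2.2) ^ 2))

/-- The time-`s` section of the graph of `T`. -/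
def graphSection {n : ℕ} (T : ℝ → EuclideanSpace ℝ (Fin n) → Set (ℝ × ℝ)) (s : ℝ) :
    Set (EuclideanSpace ℝ (Fin n) × ℝ × ℝ) :=
  {g | (g.2.1, g.2.2) ∈ T s g.1}

theorem liminf_eq_zero_iff_frequently_lt {α : Type*} (u : α → ℝ≥0∞) (f : Filter α) :
    liminf u f = 0 ↔ ∀ ε : ℝ, 0 < ε → ∃ᶠ a in f, u a < ENNReal.ofReal ε := by
  constructor
  · intro h ε hε hf
    have hle : ENNReal.ofReal ε ≤ liminf u f :=
      le_liminf_of_le (by isBoundedDefault) (hf.mono fun _ ha => not_lt.1 ha)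
    rw [h] at hle
    exact absurd (ENNReal.ofReal_pos.2 hε) (not_lt.2 hle)
  · intro h
    by_contra hne
    obtain ⟨ε, -, hε, hεu⟩ := ENNReal.lt_iff_exists_real_btwn.1 (pos_iff_ne_zero.2 hne)
    exact h ε (ENNReal.ofReal_pos.1 hε)
      ((eventually_lt_of_lt_liminf hεu).mono fun _ ha => not_lt.2 ha.le)

theorem iInf_ofReal_div_lt_iff {α : Type*} (A : Set α) (g : α → ℝ) {δ ε : ℝ} (hδ : 0 < δ)
    (hε : 0 < ε) :
    (⨅ a ∈ A, ENNReal.ofReal (g a)) / ENNReal.ofReal δ < ENNReal.ofReal ε ↔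
      ∃ a ∈ A, g a < ε * δ := by
  rw [ENNReal.div_lt_iff (Or.inl (ENNReal.ofReal_pos.2 hδ).ne') (Or.inl ENNReal.ofReal_ne_top),
    ← ENNReal.ofReal_mul hε.le]
  simp only [iInf_lt_iff, ENNReal.ofReal_lt_ofReal_iff (mul_pos hε hδ), exists_prop]

theorem sqrt_sum_sq_le_add_abs {a : ℝ} (b c : ℝ) (ha : 0 ≤ a) :
    √(a ^ 2 + b ^ 2 + c ^ 2) ≤ a + (|b| + |c|) := by
  apply Real.sqrt_le_iff.2 ⟨by positivity, _⟩
  rw [← sq_abs b, ← sq_abs c]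
  nlinarith [mul_nonneg ha (abs_nonneg b), mul_nonneg ha (abs_nonneg c),
    mul_nonneg (abs_nonneg b) (abs_nonneg c)]

/-- `D̂T(t,x;(J₁,J₂),w) = 0` if and only if
`liminf_{δ↓0} d((x+δw, J₁, J₂), G[t+δ])/δ = 0`, where `G[s]` is the time-`s` section of the
graph of `T` and `d` is the Euclidean distance in `ℝⁿ×ℝ²`. -/
theorem Dhat_eq_zero_iff_section_dist
    {n : ℕ} (t₀ θ₀ : ℝ) (ht : t₀ < θ₀)
    (T : ℝ → EuclideanSpace ℝ (Fin n) → Set (ℝ × ℝ))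
    (hT_ne : ∀ t ∈ Icc t₀ θ₀, ∀ x : EuclideanSpace ℝ (Fin n), (T t x).Nonempty)
    (hT_cpt : ∀ t ∈ Icc t₀ θ₀, ∀ x : EuclideanSpace ℝ (Fin n), IsCompact (T t x))
    (t : ℝ) (htmem : t ∈ Ico t₀ θ₀) (x : EuclideanSpace ℝ (Fin n))
    (J : ℝ × ℝ) (hJ : J ∈ T t x) (w : EuclideanSpace ℝ (Fin n)) :
    Dhat T t x J w = 0 ↔
      Filter.liminf (fun δ : ℝ =>
          eucDist (x + δ • w) J (graphSection T (t + δ)) / ENNReal.ofReal δ)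
        (𝓝[>] (0 : ℝ)) = 0 := by
  rw [Dhat, liminf_eq_zero_iff_frequently_lt, liminf_eq_zero_iff_frequently_lt]
  have hpos : ∀ᶠ δ : ℝ in 𝓝[>] 0, 0 < δ := self_mem_nhdsWithin
  constructor
  · intro h ε hε
    have hball : ∀ᶠ p : ℝ × EuclideanSpace ℝ (Fin n) in 𝓝[>] (0 : ℝ) ×ˢ 𝓝 w,
        0 < p.1 ∧ dist p.2 w < ε / 2 :=
      hpos.prod_mk (Metric.ball_mem_nhds w (half_pos hε))
    refine (tendsto_fst (f := 𝓝[>] (0 : ℝ)) (g := 𝓝 w)).frequently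
      (((h (ε / 2) (half_pos hε)).and_eventually hball).mono ?_)
    rintro ⟨δ, v⟩ ⟨hlt, hδ, hv⟩
    simp only at hlt hδ hv ⊢
    obtain ⟨ζ, hζ, hζJ⟩ := (iInf_ofReal_div_lt_iff _ _ hδ (half_pos hε)).1 hlt
    refine (iInf_ofReal_div_lt_iff _ _ hδ hε).2 ⟨(x + δ • v, ζ), hζ, ?_⟩
    have hnorm : ‖x + δ • w - (x + δ • v)‖ = δ * dist v w := by
      rw [add_sub_add_left_eq_sub, ← smul_sub, norm_smul, Real.norm_of_nonneg hδ.le,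
        dist_comm, dist_eq_norm]
    have hsqrt := sqrt_sum_sq_le_add_abs (J.1 - ζ.1) (J.2 - ζ.2)
      (norm_nonneg (x + δ • w - (x + δ • v)))
    rw [abs_sub_comm J.1, abs_sub_comm J.2] at hsqrt
    refine hsqrt.trans_lt ?_
    rw [hnorm]
    nlinarith [mul_lt_mul_of_pos_left hv hδ]
  · intro h ε hε hev
    obtain ⟨U, hU, V, hV, hUV⟩ := Filter.mem_prod_iff.1 hev
    obtain ⟨r, hr, hrV⟩ := Metric.mem_nhds_iff.1 hV
    have hη : 0 < min (ε / 2) r := lt_min (half_pos hε) hr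
    obtain ⟨δ, hlt, hδU, hδ⟩ := ((h _ hη).and_eventually (Filter.Eventually.and hU hpos)).exists
    obtain ⟨⟨y, ζ⟩, hζ, hdist⟩ := (iInf_ofReal_div_lt_iff _ _ hδ hη).1 hlt
    simp only at hdist
    have hζ : ζ ∈ T (t + δ) y := hζ
    have hy : x + δ • (δ⁻¹ • (y - x)) = y := by
      rw [smul_inv_smul₀ hδ.ne', add_sub_cancel]
    have hnorm : ‖x + δ • w - y‖ = δ * dist (δ⁻¹ • (y - x)) w := by
      nth_rewrite 1 [← hy]
      rw [add_sub_add_left_eq_sub, ← smul_sub, norm_smul, Real.norm_of_nonneg hδ.le,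
        dist_comm, dist_eq_norm]
    have hv : δ⁻¹ • (y - x) ∈ V := by
      refine hrV (Metric.mem_ball.2 (lt_of_mul_lt_mul_left ?_ hδ.le))
      rw [← hnorm, mul_comm δ r]
      refine (Real.le_sqrt_of_sq_le ?_).trans_lt
        (hdist.trans_le (mul_le_mul_of_nonneg_right (min_le_right _ _) hδ.le))
      nlinarith [sq_nonneg (J.1 - ζ.1), sq_nonneg (J.2 - ζ.2)]
    refine hUV (Set.mk_mem_prod hδU hv) ?_
    refine (iInf_ofReal_div_lt_iff _ _ hδ hε).2 ⟨ζ, by simpa only [hy] using hζ, ?_⟩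
    have hdist' := hdist.trans_le (mul_le_mul_of_nonneg_right (min_le_left _ r) hδ.le)
    have h1 : |J.1 - ζ.1| < ε / 2 * δ := by
      refine (Real.abs_le_sqrt ?_).trans_lt hdist'
      nlinarith [sq_nonneg (‖x + δ • w - y‖), sq_nonneg (J.2 - ζ.2)]
    have h2 : |J.2 - ζ.2| < ε / 2 * δ := by
      refine (Real.abs_le_sqrt ?_).trans_lt hdist'
      nlinarith [sq_nonneg (‖x + δ • w - y‖), sq_nonneg (J.1 - ζ.1)]
    rw [abs_sub_comm ζ.1, abs_sub_comm ζ.2]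
    linarith
end
end

section
/- For every t ∈ [0,1] and all x*,y* ∈ ℝ: the supremum, over all measurable functions u,v : [t,1] → [−1,1], of −|(x* + ∫_t^1 u(ξ)dξ) − (y* + ∫_t^1 v(ξ)dξ)| equals min{−|x*−y*| + 2(1−t), 0}. -/
open Set Filter MeasureTheory intervalIntegral

noncomputable section

/-- A real number of absolute value at most `L` can be chosen within `max (|d| - L) 0` of `d`. -/
theorem exists_mem_Icc_mul_neg_abs_sub_eq (d : ℝ) {L : ℝ} (hL : 0 ≤ L) :
    ∃ c ∈ Icc (-1 : ℝ) 1, -|d - c * L| = min (-|d| + L) 0 := by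
  rcases le_or_gt |d| L with h | h
  · have hd := abs_le.mp h
    refine ⟨d / L, abs_le.mp ?_, ?_⟩
    · rw [abs_div, abs_of_nonneg hL]
      exact div_le_one_of_le₀ h hL
    · have hdL : d / L * L = d := by
        refine div_mul_cancel_of_imp fun h0 => ?_
        subst h0
        linarith
      rw [hdL, min_eq_right (by linarith)]
      simp
  · rw [min_eq_left (by linarith)]
    rcases le_total 0 d with hd | hd
    · rw [abs_of_nonneg hd] at h ⊢
      refine ⟨1, by norm_num, ?_⟩
      rw [abs_of_nonneg (by linarith)]
      ring
    · rw [abs_of_nonpos hd] at h ⊢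
      refine ⟨-1, by norm_num, ?_⟩
      rw [abs_of_nonpos (by linarith)]
      ring

/-- The integral over `[t, 1]` of a function with values in `[-1, 1]` is at most `1 - t` in
absolute value. -/
theorem abs_integral_le_one_sub {t : ℝ} (ht : t ≤ 1) {u : ℝ → ℝ}
    (hu : ∀ ξ, u ξ ∈ Icc (-1 : ℝ) 1) : |∫ ξ in t..1, u ξ| ≤ 1 - t := by
  have h := norm_integral_le_of_norm_le_const (a := t) (b := 1) (f := u) (C := 1)
    fun ξ _ => abs_le.mpr (hu ξ)
  rwa [one_mul, abs_of_nonneg (sub_nonneg.mpr ht)] at h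

/-- In the game `ẋ = u`, `ẏ = v`, `u,v ∈ [-1,1]`, on `[0,1]`, the best value of the terminal
payoff `σ₁(x,y) = -|x-y|` achievable by joint open-loop controls starting from `(x*,y*)` at
time `t` is `c₁⁺(t,x*,y*) = min{-|x*-y*| + 2(1-t), 0}`. -/
theorem best_joint_payoff_eq
    (t : ℝ) (ht : t ∈ Icc (0 : ℝ) 1) (xstar ystar : ℝ) :
    sSup {r : ℝ | ∃ u v : ℝ → ℝ, Measurable u ∧ Measurable v ∧
        (∀ ξ, u ξ ∈ Icc (-1 : ℝ) 1) ∧ (∀ ξ, v ξ ∈ Icc (-1 : ℝ) 1) ∧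
        r = -|(xstar + ∫ ξ in t..1, u ξ) - (ystar + ∫ ξ in t..1, v ξ)|} =
      min (-|xstar - ystar| + 2 * (1 - t)) 0 := by
  refine IsGreatest.csSup_eq ⟨?_, ?_⟩
  · obtain ⟨c, hc, h⟩ := exists_mem_Icc_mul_neg_abs_sub_eq (xstar - ystar)
      (L := 2 * (1 - t)) (by linarith [ht.2])
    refine ⟨fun _ => -c, fun _ => c, measurable_const, measurable_const,
      fun _ => ⟨neg_le_neg hc.2, neg_le.mp hc.1⟩, fun _ => hc, ?_⟩
    rw [← h, intervalIntegral.integral_const, intervalIntegral.integral_const, smul_eq_mul,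
      smul_eq_mul]
    congr 2
    ring
  · rintro r ⟨u, v, -, -, hu, hv, rfl⟩
    refine le_min ?_ (neg_nonpos.mpr (abs_nonneg _))
    have hU := abs_le.mp (abs_integral_le_one_sub ht.2 hu)
    have hV := abs_le.mp (abs_integral_le_one_sub ht.2 hv)
    have hd : |xstar - ystar| ≤
        |(xstar + ∫ ξ in t..1, u ξ) - (ystar + ∫ ξ in t..1, v ξ)| + 2 * (1 - t) := by
      have h := abs_le.mp (le_refl
        |(xstar + ∫ ξ in t..1, u ξ) - (ystar + ∫ ξ in t..1, v ξ)|)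
      exact abs_le.mpr ⟨by linarith, by linarith⟩
    linarith
end
end

section
/- For every γ ∈ [0,2], every t ∈ (0,1), all x,y ∈ ℝ, and every (a,s_x,s_y) ∈ D⁺c₁^γ(t,x,y), one has a + |s_x| − |s_y| ≤ 0. -/
open Set Filter
open scoped Topology

noncomputable section

/-- Euclidean inner product on `ℝ³ = ℝ × ℝ × ℝ`. -/
def dot3 (p z : ℝ × ℝ × ℝ) : ℝ := p.1 * z.1 + p.2.1 * z.2.1 + p.2.2 * z.2.2

/-- The Fréchet superdifferential of `φ : ℝ³ → ℝ` at `z`: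
`D⁺φ(z) = {p : limsup_{z'→z, z'≠z} (φ(z') - φ(z) - ⟨p, z'-z⟩)/‖z'-z‖ ≤ 0}`. -/
def superDiff (φ : ℝ × ℝ × ℝ → ℝ) (z : ℝ × ℝ × ℝ) : Set (ℝ × ℝ × ℝ) :=
  {p | Filter.limsup
      (fun z' : ℝ × ℝ × ℝ => ((φ z' - φ z - dot3 p (z' - z)) / ‖z' - z‖ : EReal))
      (𝓝[≠] z) ≤ 0}

/-- `c₁^γ(t,x,y) = -|x-y|` if `y ≥ x`, and `min{-|x-y| + γ(1-t), 0}` if `y < x`;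
the argument is `z = (t,x,y)`. -/
def c1gamma (γ : ℝ) (z : ℝ × ℝ × ℝ) : ℝ :=
  if z.2.2 ≥ z.2.1 then -|z.2.1 - z.2.2| else min (-|z.2.1 - z.2.2| + γ * (1 - z.1)) 0

/-- If `φ` does not decrease from `z` along the ray in direction `v`, then every supergradient
of `φ` at `z` has nonnegative pairing with `v`. -/
theorem dot3_nonneg_of_mem_superDiff {φ : ℝ × ℝ × ℝ → ℝ} {z p v : ℝ × ℝ × ℝ}
    (hp : p ∈ superDiff φ z) (hφ : ∀ h : ℝ, 0 < h → φ z ≤ φ (z + h • v)) :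
    0 ≤ dot3 p v := by
  by_contra! hneg
  have hv : v ≠ 0 := by
    rintro rfl
    simp [dot3] at hneg
  have hv' : 0 < ‖v‖ := norm_pos_iff.mpr hv
  have hc : (0 : EReal) < ((-dot3 p v / ‖v‖ : ℝ) : EReal) :=
    EReal.coe_pos.mpr (div_pos (neg_pos.mpr hneg) hv')
  have hev := Filter.eventually_lt_of_limsup_lt (lt_of_le_of_lt hp hc)
  have htend : Tendsto (fun h : ℝ => z + h • v) (𝓝[>] 0) (𝓝[≠] z) := by
    refine tendsto_nhdsWithin_iff.mpr ⟨?_, ?_⟩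
    · have hcont : Continuous fun h : ℝ => z + h • v := by fun_prop
      simpa using (hcont.tendsto 0).mono_left nhdsWithin_le_nhds
    · filter_upwards [self_mem_nhdsWithin] with h hh
      simpa using ⟨ne_of_gt hh, hv⟩
  obtain ⟨h, hlt, hh⟩ := ((htend.eventually hev).and self_mem_nhdsWithin).exists
  have hh : 0 < h := hh
  rw [← EReal.coe_sub, ← EReal.coe_sub, ← EReal.coe_div, EReal.coe_lt_coe_iff,
    add_sub_cancel_left, norm_smul, Real.norm_of_nonneg hh.le,
    div_lt_div_iff₀ (mul_pos hh hv') hv'] at hlt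
  have hdot : dot3 p (h • v) = h * dot3 p v := by
    simp only [dot3, Prod.smul_fst, Prod.smul_snd, smul_eq_mul]
    ring
  rw [hdot] at hlt
  nlinarith [mul_nonneg (sub_nonneg.mpr (hφ h hh)) hv'.le]

/-- `c₁^γ` is invariant under translations along the diagonal of the space variables. -/
theorem c1gamma_add_diagonal (γ : ℝ) (z : ℝ × ℝ × ℝ) (d : ℝ) :
    c1gamma γ (z + (0, d, d)) = c1gamma γ z := by
  simp [c1gamma]

/-- `c₁^γ` is nonincreasing in time. -/
theorem c1gamma_antitone_time {γ : ℝ} (hγ : 0 ≤ γ) (x y : ℝ) :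
    Antitone fun t => c1gamma γ (t, x, y) := by
  intro s t hst
  simp only [c1gamma]
  split_ifs
  · exact le_rfl
  · gcongr

/-- `c₁^γ` is an upper solution of the Hamilton–Jacobi equation
`∂c/∂t + |∂c/∂x| - |∂c/∂y| = 0`: every `(a,s_x,s_y) ∈ D⁺c₁^γ(t,x,y)` satisfies
`a + |s_x| - |s_y| ≤ 0`. -/
theorem c1gamma_upper_solution
    (γ : ℝ) (hγ : γ ∈ Icc (0 : ℝ) 2) (t : ℝ) (htmem : t ∈ Ioo (0 : ℝ) 1) (x y : ℝ)
    (a sx sy : ℝ) (hmem : (a, sx, sy) ∈ superDiff (c1gamma γ) (t, x, y)) :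
    a + |sx| - |sy| ≤ 0 := by
  have hdiag (e : ℝ) : 0 ≤ dot3 (a, sx, sy) (0, e, e) :=
    dot3_nonneg_of_mem_superDiff hmem fun h _ => by
      simpa using (c1gamma_add_diagonal γ (t, x, y) (h * e)).ge
  have htime : 0 ≤ dot3 (a, sx, sy) (-1, 0, 0) :=
    dot3_nonneg_of_mem_superDiff hmem fun h hh => by
      simpa using c1gamma_antitone_time hγ.1 x y (show t + -h ≤ t by linarith)
  have hpos := hdiag 1
  have hneg := hdiag (-1)
  simp only [dot3] at hpos hneg htime
  have hs : sx = -sy := by linarith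
  rw [hs, abs_neg]
  linarith
end
end

section
/- For every γ ∈ (0,2], every t ∈ (0,1) and all x,y ∈ ℝ, the Fréchet superdifferential of c₁^γ at (t,x,y) is given by: D⁺c₁^γ(t,x,y) = {(0,1,−1)} if y > x; {(0,0,0)} if y < x < y + γ(1−t); {(−γ,−1,1)} if x > y + γ(1−t); {(0,λ,−λ) : λ ∈ [0,1]} if x = y; and {(−λγ,−λ,λ) : λ ∈ [0,1]} if x = y + γ(1−t). -/
open Set Filter
open scoped Topology

noncomputable section

theorem mem_superDiff_iff {φ : ℝ × ℝ × ℝ → ℝ} {z p : ℝ × ℝ × ℝ} :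
    p ∈ superDiff φ z ↔
      ∀ ε > 0, ∀ᶠ z' in 𝓝 z, φ z' - φ z - dot3 p (z' - z) ≤ ε * ‖z' - z‖ := by
  have key : ∀ z' : ℝ × ℝ × ℝ,
      ((φ z' - φ z - dot3 p (z' - z)) / ‖z' - z‖ : EReal) =
        (((φ z' - φ z - dot3 p (z' - z)) / ‖z' - z‖ : ℝ) : EReal) := fun z' => by
    rw [EReal.coe_div, EReal.coe_sub, EReal.coe_sub]
  simp only [superDiff, mem_ofPred_eq, key]
  rw [limsup_le_iff]
  constructor
  · intro h ε hε
    have h1 := h (ε : EReal) (by exact_mod_cast hε)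
    rw [eventually_nhdsWithin_iff] at h1
    filter_upwards [h1] with z' hz'
    by_cases hne : z' = z
    · simp [hne, dot3]
    · have hlt : (φ z' - φ z - dot3 p (z' - z)) / ‖z' - z‖ < ε := by
        exact_mod_cast hz' hne
      rw [div_lt_iff₀ (norm_pos_iff.2 (sub_ne_zero.2 hne))] at hlt
      exact hlt.le
  · intro h y hy
    obtain ⟨ε, hε, hεy⟩ := EReal.lt_iff_exists_real_btwn.1 hy
    rw [eventually_nhdsWithin_iff]
    filter_upwards [h ε (by exact_mod_cast hε)] with z' hz' hne
    refine lt_of_le_of_lt ?_ hεy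
    rw [EReal.coe_le_coe_iff, div_le_iff₀ (norm_pos_iff.2 (sub_ne_zero.2 hne))]
    exact hz'

/-- If the increments of `φ` at `z` are locally given by a positively homogeneous function `g`,
then the superdifferential consists of the linear majorants of `g`. -/
theorem superDiff_eq_of_eventually_homogeneous {φ g : ℝ × ℝ × ℝ → ℝ} {z : ℝ × ℝ × ℝ}
    (hg : ∀ s > 0, ∀ v, g (s • v) = s * g v)
    (hφ : ∀ᶠ z' in 𝓝 z, φ z' - φ z = g (z' - z)) :
    superDiff φ z = {p | ∀ v, g v ≤ dot3 p v} := by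
  ext p
  rw [mem_superDiff_iff, mem_ofPred_eq]
  constructor
  · intro h v
    refine le_of_forall_pos_le_add fun δ hδ => ?_
    have hv : 0 < ‖v‖ + 1 := by positivity
    have hε : 0 < δ / (‖v‖ + 1) := by positivity
    have ht : Tendsto (fun s : ℝ => z + s • v) (𝓝[>] 0) (𝓝 z) := by
      have hc : Continuous fun s : ℝ => z + s • v := by fun_prop
      exact tendsto_nhdsWithin_of_tendsto_nhds (by simpa using hc.tendsto 0)
    obtain ⟨s, ⟨hs1, hs2⟩, hs⟩ :=
      ((ht.eventually ((h _ hε).and hφ)).and self_mem_nhdsWithin).exists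
    have hs0 : 0 < s := hs
    rw [hs2, add_sub_cancel_left, hg s hs0, norm_smul, Real.norm_of_nonneg hs0.le] at hs1
    have hd : dot3 p (s • v) = s * dot3 p v := by
      simp only [dot3, Prod.smul_fst, Prod.smul_snd, smul_eq_mul]; ring
    rw [hd] at hs1
    have h1 : g v - dot3 p v ≤ δ / (‖v‖ + 1) * ‖v‖ := by
      refine le_of_mul_le_mul_left ?_ hs0
      linarith
    have h2 : δ / (‖v‖ + 1) * ‖v‖ ≤ δ := by
      rw [div_mul_eq_mul_div, div_le_iff₀ hv]
      nlinarith
    linarith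
  · intro h ε hε
    filter_upwards [hφ] with z' hz'
    rw [hz']
    have := h (z' - z)
    have : 0 ≤ ε * ‖z' - z‖ := by positivity
    linarith

theorem superDiff_eq_singleton {φ : ℝ × ℝ × ℝ → ℝ} {z q : ℝ × ℝ × ℝ}
    (hφ : ∀ᶠ z' in 𝓝 z, φ z' - φ z = dot3 q (z' - z)) : superDiff φ z = {q} := by
  rw [superDiff_eq_of_eventually_homogeneous _ hφ]
  · ext p
    obtain ⟨a, b, c⟩ := p
    obtain ⟨a', b', c'⟩ := q
    simp only [mem_ofPred_eq, mem_singleton_iff, Prod.mk.injEq]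
    constructor
    · intro h
      have h1 := h (1, 0, 0)
      have h2 := h (-1, 0, 0)
      have h3 := h (0, 1, 0)
      have h4 := h (0, -1, 0)
      have h5 := h (0, 0, 1)
      have h6 := h (0, 0, -1)
      simp only [dot3] at h1 h2 h3 h4 h5 h6
      refine ⟨?_, ?_, ?_⟩ <;> linarith
    · rintro ⟨rfl, rfl, rfl⟩ v
      exact le_rfl
  · intro s _ v
    simp only [dot3, Prod.smul_fst, Prod.smul_snd, smul_eq_mul]
    ring

theorem superDiff_eq_of_eventually_min {φ : ℝ × ℝ × ℝ → ℝ} {z : ℝ × ℝ × ℝ} {a b : ℝ}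
    (hb : b ≠ 0)
    (hφ : ∀ᶠ z' in 𝓝 z, φ z' - φ z = min (dot3 (a, b, -b) (z' - z)) 0) :
    superDiff φ z = {p | ∃ l ∈ Icc (0 : ℝ) 1, p = (l * a, l * b, -(l * b))} := by
  rw [superDiff_eq_of_eventually_homogeneous (g := fun v => min (dot3 (a, b, -b) v) 0) _ hφ]
  · ext ⟨p, q, r⟩
    simp only [mem_ofPred_eq, Prod.mk.injEq]
    constructor
    · intro h
      have h1 := h (0, 1, 1)
      have h2 := h (0, -1, -1)
      have h3 := h (1, -a / b, 0)
      have h4 := h (-1, a / b, 0)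
      have h5 := h (0, 1 / b, 0)
      have h6 := h (0, -1 / b, 0)
      have e1 : b * (-a / b) = -a := by field_simp
      have e2 : b * (a / b) = a := by field_simp
      have e3 : b * (1 / b) = 1 := by field_simp
      have e4 : b * (-1 / b) = -1 := by field_simp
      simp only [dot3, e1, e2, e3, e4] at h1 h2 h3 h4 h5 h6
      norm_num at h1 h2 h3 h4 h5 h6
      have hq : q / b * b = q := by field_simp
      refine ⟨q / b, ⟨?_, ?_⟩, ?_, hq.symm, ?_⟩
      · rw [div_eq_mul_inv]; linarith
      · have : q * (-1 / b) = -(q / b) := by ring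
        rw [this] at h6; linarith
      · have i1 : q * (-a / b) = -(q / b * a) := by ring
        have i2 : q * (a / b) = q / b * a := by ring
        rw [i1] at h3; rw [i2] at h4; linarith
      · rw [hq]; linarith
    · rintro ⟨l, ⟨hl0, hl1⟩, rfl, rfl, rfl⟩ v
      have hd : dot3 (l * a, l * b, -(l * b)) v = l * dot3 (a, b, -b) v := by
        simp only [dot3]; ring
      rw [hd]
      rcases le_total (dot3 (a, b, -b) v) 0 with h | h
      · rw [min_eq_left h]; nlinarith
      · rw [min_eq_right h]; positivity
  · intro s hs v
    have hd : dot3 (a, b, -b) (s • v) = s * dot3 (a, b, -b) v := by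
      simp only [dot3, Prod.smul_fst, Prod.smul_snd, smul_eq_mul]; ring
    simp only [hd, mul_min_of_nonneg _ _ hs.le, mul_zero]

theorem c1gamma_of_le {γ : ℝ} {z : ℝ × ℝ × ℝ} (h : z.2.1 ≤ z.2.2) :
    c1gamma γ z = z.2.1 - z.2.2 := by
  rw [c1gamma, if_pos h, abs_of_nonpos (by linarith)]
  ring

theorem c1gamma_of_lt {γ : ℝ} {z : ℝ × ℝ × ℝ} (h : z.2.2 < z.2.1) :
    c1gamma γ z = min (-(z.2.1 - z.2.2) + γ * (1 - z.1)) 0 := by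
  rw [c1gamma, if_neg (not_le.2 h), abs_of_pos (by linarith)]

/-- Computation of the Fréchet superdifferential of `c₁^γ` at every point
`(t,x,y)` with `t ∈ (0,1)`, for `γ ∈ (0,2]`. -/
theorem superDiff_c1gamma
    (γ : ℝ) (hγ : γ ∈ Ioc (0 : ℝ) 2) (t : ℝ) (htmem : t ∈ Ioo (0 : ℝ) 1) (x y : ℝ) :
    (y > x → superDiff (c1gamma γ) (t, x, y) = {((0 : ℝ), (1 : ℝ), (-1 : ℝ))}) ∧
    (y < x ∧ x < y + γ * (1 - t) →
      superDiff (c1gamma γ) (t, x, y) = {((0 : ℝ), (0 : ℝ), (0 : ℝ))}) ∧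
    (x > y + γ * (1 - t) → superDiff (c1gamma γ) (t, x, y) = {(-γ, (-1 : ℝ), (1 : ℝ))}) ∧
    (x = y → superDiff (c1gamma γ) (t, x, y) =
      {p : ℝ × ℝ × ℝ | ∃ l ∈ Icc (0 : ℝ) 1, p = (0, l, -l)}) ∧
    (x = y + γ * (1 - t) → superDiff (c1gamma γ) (t, x, y) =
      {p : ℝ × ℝ × ℝ | ∃ l ∈ Icc (0 : ℝ) 1, p = (-l * γ, -l, l)}) := by
  have hpos : 0 < γ * (1 - t) := mul_pos hγ.1 (sub_pos.2 htmem.2)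
  have near {f g : ℝ × ℝ × ℝ → ℝ} (hf : Continuous f) (hg : Continuous g)
      (h : f (t, x, y) < g (t, x, y)) : ∀ᶠ z in 𝓝 (t, x, y), f z < g z :=
    hf.continuousAt.eventually_lt hg.continuousAt h
  refine ⟨fun h => ?_, fun h => ?_, fun h => ?_, fun h => ?_, fun h => ?_⟩
  · refine superDiff_eq_singleton ?_
    filter_upwards [near (f := fun z => z.2.1) (g := fun z => z.2.2)
      (by fun_prop) (by fun_prop) h] with z hz
    rw [c1gamma_of_le hz.le, c1gamma_of_le (z := (t, x, y)) h.le]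
    simp only [dot3, Prod.fst_sub, Prod.snd_sub]
    ring
  · refine superDiff_eq_singleton ?_
    filter_upwards [near (f := fun z => z.2.2) (g := fun z => z.2.1)
      (by fun_prop) (by fun_prop) h.1,
      near (f := fun z => z.2.1) (g := fun z => z.2.2 + γ * (1 - z.1))
      (by fun_prop) (by fun_prop) h.2] with z hz hz'
    rw [c1gamma_of_lt hz, c1gamma_of_lt (z := (t, x, y)) h.1, min_eq_right (by linarith),
      min_eq_right (by linarith [h.2])]
    simp [dot3]
  · have hyx : y < x := by linarith
    refine superDiff_eq_singleton ?_
    filter_upwards [near (f := fun z => z.2.2) (g := fun z => z.2.1)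
      (by fun_prop) (by fun_prop) hyx,
      near (f := fun z => z.2.2 + γ * (1 - z.1)) (g := fun z => z.2.1)
      (by fun_prop) (by fun_prop) h] with z hz hz'
    rw [c1gamma_of_lt hz, c1gamma_of_lt (z := (t, x, y)) hyx, min_eq_left (by linarith),
      min_eq_left (by linarith)]
    simp only [dot3, Prod.fst_sub, Prod.snd_sub]
    ring
  · subst h
    rw [superDiff_eq_of_eventually_min (a := 0) (b := 1) one_ne_zero]
    · simp only [mul_zero, mul_one]
    filter_upwards [near (f := fun z => z.2.1) (g := fun z => z.2.2 + γ * (1 - z.1))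
      (by fun_prop) (by fun_prop) (lt_add_of_pos_right x hpos)] with z hz
    have hd : dot3 (0, 1, -1) (z - (t, x, x)) = z.2.1 - z.2.2 := by
      simp only [dot3, Prod.fst_sub, Prod.snd_sub]
      ring
    rw [c1gamma_of_le (z := (t, x, x)) le_rfl, hd, sub_self, sub_zero]
    rcases le_or_gt z.2.1 z.2.2 with hle | hlt
    · rw [c1gamma_of_le hle, min_eq_left (by linarith)]
    · rw [c1gamma_of_lt hlt, min_eq_right (by linarith), min_eq_right (by linarith)]
  · have hyx : y < x := by linarith
    rw [superDiff_eq_of_eventually_min (a := -γ) (b := -1) (by norm_num)]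
    · simp only [mul_neg, mul_one, neg_neg, neg_mul]
    filter_upwards [near (f := fun z => z.2.2) (g := fun z => z.2.1)
      (by fun_prop) (by fun_prop) hyx] with z hz
    have hd : dot3 (-γ, -1, -(-1)) (z - (t, x, y)) = -(z.2.1 - z.2.2) + γ * (1 - z.1) := by
      simp only [dot3, Prod.fst_sub, Prod.snd_sub]
      linarith
    rw [c1gamma_of_lt hz, c1gamma_of_lt (z := (t, x, y)) hyx, hd,
      min_eq_right (a := -((t, x, y).2.1 - (t, x, y).2.2) + _) (by linarith), sub_zero]
end
end

section
/- Let T : [0,1]×ℝ² → 𝒫(ℝ²) be a set-valued map satisfying T(t,x,y) ⊆ ℝ × {y + (1−t)} for every (t,x,y) ∈ [0,1]×ℝ². Then for every (t,x,y) ∈ [0,1)×ℝ², every (J₁,J₂) ∈ ℝ² with J₂ = y + (1−t), and every (u,v) ∈ ℝ²: D̂T(t,(x,y);(J₁,J₂),(u,v)) ≥ |v − 1|. -/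
open Set Filter
open scoped ENNReal NNReal Topology

noncomputable section

/-- If `T(t,x,y) ⊆ ℝ × {y + (1-t)}` for all `(t,x,y) ∈ [0,1]×ℝ²`, then for every
`(t,x,y) ∈ [0,1)×ℝ²`, `(J₁,J₂)` with `J₂ = y + (1-t)`, and `(u,v) ∈ ℝ²`,
`D̂T(t,(x,y);(J₁,J₂),(u,v)) ≥ |v - 1|`. -/
theorem Dhat_ge_abs_v_sub_one
    (T : ℝ → ℝ × ℝ → Set (ℝ × ℝ))
    (hT : ∀ t ∈ Icc (0 : ℝ) 1, ∀ z : ℝ × ℝ, T t z ⊆ {J : ℝ × ℝ | J.2 = z.2 + (1 - t)})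
    (t : ℝ) (htmem : t ∈ Ico (0 : ℝ) 1) (x y J₁ J₂ : ℝ) (hJ₂ : J₂ = y + (1 - t))
    (u v : ℝ) :
    ENNReal.ofReal |v - 1| ≤ Dhat T t (x, y) (J₁, J₂) (u, v) := by
  have hlim : Tendsto (fun p : ℝ × ℝ × ℝ => ENNReal.ofReal |p.2.2 - 1|)
      ((𝓝[>] (0 : ℝ)) ×ˢ 𝓝 (u, v)) (𝓝 (ENNReal.ofReal |v - 1|)) := by
    have hcont : Continuous fun w : ℝ × ℝ => ENNReal.ofReal |w.2 - 1| :=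
      ENNReal.continuous_ofReal.comp (by fun_prop)
    exact (hcont.tendsto (u, v)).comp tendsto_snd
  have hpos : ∀ᶠ δ : ℝ in 𝓝[>] 0, δ ∈ Ioo 0 (1 - t) :=
    Ioo_mem_nhdsGT (by linarith [htmem.2])
  rw [← hlim.liminf_eq]
  refine liminf_le_liminf ?_
  filter_upwards [tendsto_fst.eventually hpos] with p hp
  obtain ⟨hp0, hp1⟩ := hp
  rw [ENNReal.le_div_iff_mul_le (Or.inl (by simpa using hp0)) (Or.inl ENNReal.ofReal_ne_top),
    ← ENNReal.ofReal_mul (abs_nonneg _)]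
  refine le_iInf₂ fun ζ hζ => ENNReal.ofReal_le_ofReal ?_
  have h2 : ζ.2 = y + p.1 * p.2.2 + (1 - (t + p.1)) := by
    simpa using hT (t + p.1) ⟨by linarith [htmem.1], by linarith⟩ _ hζ
  have h3 : ζ.2 - J₂ = (p.2.2 - 1) * p.1 := by rw [h2, hJ₂]; ring
  rw [h3, abs_mul, abs_of_pos hp0]
  exact le_add_of_nonneg_left (abs_nonneg _)
end
end

section
/- Let T : [0,1]×ℝ² → 𝒫(ℝ²) be a set-valued map satisfying: (i) T(t,x,y) ⊆ [−|x−y|, ∞) × {y+(1−t)} for all (t,x,y) ∈ [0,1]×ℝ²; (ii) T(1,x,y) ⊆ {(−|x−y|, y)} for all (x,y) ∈ ℝ²; (iii) for every (t*,x*,y*) ∈ [0,1]×ℝ² and every (J₁,J₂) ∈ T(t*,x*,y*) there exists a Lipschitz trajectory (x(·),y(·)) : [t*,1] → ℝ² with (x(t*),y(t*)) = (x*,y*), (x'(s),y'(s)) ∈ [−1,1]² for almost every s, and (J₁,J₂) ∈ T(s,x(s),y(s)) for all s ∈ [t*,1]. Then for every (t,x*,y*) ∈ [0,1]×ℝ²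 with y* ≥ x*: T(t,x*,y*) ⊆ {(x*−y*, y*+(1−t))}. -/
open Set Filter MeasureTheory
open scoped Topology

noncomputable section

/-- An absolutely continuous function whose derivative is almost everywhere at most `C`
grows at rate at most `C`. -/
theorem AbsolutelyContinuousOnInterval.sub_le_of_ae_deriv_le {f : ℝ → ℝ} {a b C : ℝ}
    (hf : AbsolutelyContinuousOnInterval f a b) (hab : a ≤ b)
    (hC : ∀ᵐ s ∂(volume.restrict (Icc a b)), deriv f s ≤ C) :
    f b - f a ≤ C * (b - a) := by
  rw [← hf.integral_deriv_eq_sub]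
  calc ∫ s in a..b, deriv f s ≤ ∫ _ in a..b, C :=
        intervalIntegral.integral_mono_ae_restrict hab hf.intervalIntegrable_deriv
          intervalIntegrable_const hC
    _ = C * (b - a) := by rw [intervalIntegral.integral_const, smul_eq_mul, mul_comm]

/-- Conclusion of the example's analysis for `y* ≥ x*`: any multivalued map `T` satisfying
(i) `T(t,x,y) ⊆ [-|x-y|,∞) × {y+(1-t)}`, (ii) `T(1,x,y) ⊆ {(-|x-y|, y)}` and (iii) the
viability condition (N3) for the dynamics `ẋ = u`, `ẏ = v`, `u,v ∈ [-1,1]`, satisfies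
`T(t,x*,y*) ⊆ {(x*-y*, y*+(1-t))}` whenever `y* ≥ x*`. -/
theorem nash_value_subset_singleton_of_ge
    (T : ℝ → ℝ × ℝ → Set (ℝ × ℝ))
    (h1 : ∀ t ∈ Icc (0 : ℝ) 1, ∀ z : ℝ × ℝ,
      T t z ⊆ {J : ℝ × ℝ | -|z.1 - z.2| ≤ J.1 ∧ J.2 = z.2 + (1 - t)})
    (h2 : ∀ z : ℝ × ℝ, T 1 z ⊆ {(-|z.1 - z.2|, z.2)})
    (h3 : ∀ tstar ∈ Icc (0 : ℝ) 1, ∀ zstar : ℝ × ℝ, ∀ J ∈ T tstar zstar,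
      ∃ z : ℝ → ℝ × ℝ,
        (∃ K : NNReal, LipschitzOnWith K z (Icc tstar 1)) ∧ z tstar = zstar ∧
        (∀ᵐ s ∂(volume.restrict (Icc tstar 1)), ∃ d : ℝ × ℝ,
          HasDerivAt z d s ∧ d.1 ∈ Icc (-1 : ℝ) 1 ∧ d.2 ∈ Icc (-1 : ℝ) 1) ∧
        ∀ s ∈ Icc tstar 1, J ∈ T s (z s)) :
    ∀ t ∈ Icc (0 : ℝ) 1, ∀ xstar ystar : ℝ, ystar ≥ xstar →
      T t (xstar, ystar) ⊆ {(xstar - ystar, ystar + (1 - t))} := by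
  intro t ht xstar ystar hle J hJ
  obtain ⟨z, ⟨K, hK⟩, hz, hd, hT⟩ := h3 t ht _ J hJ
  have hx : (z 1).1 - (z t).1 ≤ 1 * (1 - t) := by
    have hLip : LipschitzOnWith (1 * K) (fun s => (z s).1) (uIcc t 1) := by
      rw [uIcc_of_le ht.2]
      exact LipschitzWith.prod_fst.comp_lipschitzOnWith hK
    refine hLip.absolutelyContinuousOnInterval.sub_le_of_ae_deriv_le ht.2 ?_
    filter_upwards [hd] with s ⟨d, hds, hd1, _⟩
    have hfst : deriv (fun s => (z s).1) s = d.1 :=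
      hds.hasFDerivAt.fst.hasDerivAt.deriv.trans (by simp)
    rw [hfst]
    exact hd1.2
  obtain ⟨hJ1, hJ2⟩ := h1 t ht _ hJ
  have hend : J = (-|(z 1).1 - (z 1).2|, (z 1).2) := h2 _ (hT 1 ⟨ht.2, le_rfl⟩)
  have he1 := congrArg Prod.fst hend
  have he2 := congrArg Prod.snd hend
  rw [hz] at hx
  simp only at hJ1 hJ2 he1 he2 hx
  rw [abs_of_nonpos (by linarith)] at hJ1 he1
  exact Prod.ext (by dsimp only; linarith) hJ2
end
end

section
/- Define T : [0,1]×ℝ² → 𝒫(ℝ²) by T(t,x,y) := {(J₁, y+(1−t)) : −|x−y| ≤ J₁ ≤ c⁺(t,x,y)}, where c⁺(t,x,y) := −|x−y| if y ≥ x and c⁺(t,x,y) := min{−|x−y|+2(1−t), 0} if y < x. Then for every (t,x*,y*) ∈ [0,1]×ℝ² and every (J₁,J₂) ∈ T(t,x*,y*) there exist constants u,v ∈ [−1,1] such that the trajectory x(s) := x* + u(s−t), y(s) := y* + v(s−t) satisfies (J₁,J₂) ∈ T(s, x(s), y(s)) for all s ∈ [t,1]. -/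
open Set

noncomputable section

/-- `c⁺(t,x,y) = -|x-y|` if `y ≥ x`, and `min{-|x-y| + 2(1-t), 0}` if `y < x`. -/
def cPlus (t x y : ℝ) : ℝ :=
  if y ≥ x then -|x - y| else min (-|x - y| + 2 * (1 - t)) 0

/-- The candidate Nash-value map of the example:
`T(t,x,y) = {(J₁, y+(1-t)) : -|x-y| ≤ J₁ ≤ c⁺(t,x,y)}`. -/
def nashMap (t : ℝ) (z : ℝ × ℝ) : Set (ℝ × ℝ) :=
  {J : ℝ × ℝ | (-|z.1 - z.2| ≤ J.1 ∧ J.1 ≤ cPlus t z.1 z.2) ∧ J.2 = z.2 + (1 - t)}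

/-- Viability of the candidate Nash-value map along trajectories generated by constant
controls: for every `(t,x*,y*) ∈ [0,1]×ℝ²` and `(J₁,J₂) ∈ T(t,x*,y*)` there are constants
`u,v ∈ [-1,1]` such that `(J₁,J₂) ∈ T(s, x*+u(s-t), y*+v(s-t))` for all `s ∈ [t,1]`. -/
theorem nashMap_viable_constant_controls
    (t : ℝ) (htmem : t ∈ Icc (0 : ℝ) 1) (xstar ystar : ℝ)
    (J : ℝ × ℝ) (hJ : J ∈ nashMap t (xstar, ystar)) :
    ∃ u ∈ Icc (-1 : ℝ) 1, ∃ v ∈ Icc (-1 : ℝ) 1,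
      ∀ s ∈ Icc t 1, J ∈ nashMap s (xstar + u * (s - t), ystar + v * (s - t)) := by
  obtain ⟨a, b⟩ := J
  obtain ⟨-, ht⟩ := htmem
  obtain ⟨⟨hlow, hupp⟩, hb⟩ := hJ
  simp only at hlow hupp hb
  by_cases hyx : ystar ≥ xstar
  · refine ⟨1, by norm_num, 1, by norm_num, fun s _ => ?_⟩
    rw [cPlus, if_pos hyx] at hupp
    have hgap : xstar + 1 * (s - t) - (ystar + 1 * (s - t)) = xstar - ystar := by ring
    refine ⟨⟨?_, ?_⟩, ?_⟩
    · simpa only [hgap] using hlow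
    · rw [cPlus, if_pos (by simpa using hyx), hgap]
      exact hupp
    · simp only
      linarith
  · rw [cPlus, if_neg hyx, le_min_iff] at hupp
    push Not at hyx
    rw [abs_of_pos (sub_pos.mpr hyx)] at hlow hupp
    obtain ⟨hupp, ha⟩ := hupp
    obtain ⟨k, hk0, hk2, hk⟩ :
        ∃ k : ℝ, 0 ≤ k ∧ k ≤ 2 ∧ k * (1 - t) = a + (xstar - ystar) := by
      rcases ht.eq_or_lt with rfl | ht
      · exact ⟨0, le_rfl, by norm_num, by linarith⟩
      · have hr : 0 < 1 - t := sub_pos.mpr ht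
        exact ⟨(a + (xstar - ystar)) / (1 - t), div_nonneg (by linarith) hr.le,
          (div_le_iff₀ hr).mpr (by linarith), div_mul_cancel₀ _ hr.ne'⟩
    refine ⟨1 - k, ⟨by linarith, by linarith⟩, 1, by norm_num, fun s ⟨_, hs⟩ => ?_⟩
    have hgap : xstar + (1 - k) * (s - t) - (ystar + 1 * (s - t)) = -a + k * (1 - s) := by
      linear_combination -hk
    have hpos : 0 ≤ k * (1 - s) := mul_nonneg hk0 (sub_nonneg.mpr hs)
    have hle : k * (1 - s) ≤ 2 * (1 - s) :=
      mul_le_mul_of_nonneg_right hk2 (sub_nonneg.mpr hs)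
    have habs : |xstar + (1 - k) * (s - t) - (ystar + 1 * (s - t))| = -a + k * (1 - s) := by
      rw [hgap, abs_of_nonneg (by linarith)]
    refine ⟨⟨?_, ?_⟩, ?_⟩
    · simp only [habs]
      linarith
    · simp only [cPlus, habs]
      split_ifs with h
      · linarith
      · exact le_min (by linarith) ha
    · simp only
      linarith
end
end
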